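/- arXiv:1207.3462 — 5 statements merged into one kernel-verified Lean document; each statement's English description precedes it below -/
import Mathlib

section
/- In any finite semiorder of length H, for each 1 ≤ i ≤ H there exists an element on the i-th level that is larger than all elements on the (i+1)-th level. -/
namespace Paper

/-- Two elements are incomparable. -/
def Incomp {α : Type*} [PartialOrder α] (a b : α) : Prop := ¬ a ≤ b ∧ ¬ b ≤ a

/-- A semiorder: no induced `2+2` and no induced `3+1`. -/
def IsSemiorder (α : Type*) [PartialOrder α] : Prop :=
  (¬ ∃ x y z w : α, y < x ∧ w < z ∧ Incomp x z ∧ Incomp x w ∧ Incomp y z ∧ Incomp y w) ∧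
  (¬ ∃ x y z w : α, z < y ∧ y < x ∧ Incomp x w ∧ Incomp y w ∧ Incomp z w)

/-- There is a chain of `k` elements. -/
def HasChain (α : Type*) [Preorder α] (k : ℕ) : Prop := ∃ c : Fin k → α, StrictMono c

/-- The length of a longest chain (number of edges) is exactly `H`. -/
def HasLength (α : Type*) [Preorder α] (H : ℕ) : Prop :=
  HasChain α (H + 1) ∧ ¬ HasChain α (H + 2)

/-- There is a chain of `k` elements all strictly above `a`. -/
def HasChainAbove {α : Type*} [Preorder α] (a : α) (k : ℕ) : Prop :=
  ∃ c : Fin k → α, StrictMono c ∧ ∀ j, a < c j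

/-- `a` is on the `i`-th level (`i ≥ 1`). -/
def OnLevel {α : Type*} [Preorder α] (a : α) (i : ℕ) : Prop :=
  1 ≤ i ∧ HasChainAbove a (i - 1) ∧ ¬ HasChainAbove a i

/-- Number of isomorphism classes of partial orders on `Fin n` satisfying `pred`. -/
noncomputable def countPosets (n : ℕ) (pred : PartialOrder (Fin n) → Prop) : ℕ :=
  Nat.card (Quot (fun (P Q : {P : PartialOrder (Fin n) // pred P}) =>
    ∃ e : Fin n ≃ Fin n, ∀ a b : Fin n,
      (@LE.le _ P.1.toPreorder.toLE a b ↔ @LE.le _ Q.1.toPreorder.toLE (e a) (e b))))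

/-- Semiorder of length exactly `H`. -/
def SemiLen (n H : ℕ) (P : PartialOrder (Fin n)) : Prop :=
  @IsSemiorder (Fin n) P ∧ @HasLength (Fin n) P.toPreorder H

/-- Semiorder of length at most `h`. -/
def SemiLenLe (n h : ℕ) (P : PartialOrder (Fin n)) : Prop :=
  @IsSemiorder (Fin n) P ∧ ¬ @HasChain (Fin n) P.toPreorder (h + 2)

/-- `f_H^n`. -/
noncomputable def fEx (H n : ℕ) : ℕ := countPosets n (SemiLen n H)

/-- `f_{≤h}^n`. -/
noncomputable def fLe (h n : ℕ) : ℕ := countPosets n (SemiLenLe n h)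

/-- Ordered (plane) trees. -/
inductive PTree where
  | node : List PTree → PTree

def PTree.size : PTree → ℕ
  | .node cs => 1 + (cs.attach.map fun c => PTree.size c.1).sum
decreasing_by have := List.sizeOf_lt_of_mem c.2; simp only [PTree.node.sizeOf_spec] at *; omega

def PTree.height : PTree → ℕ
  | .node cs => (cs.attach.map fun c => PTree.height c.1 + 1).foldr max 0
decreasing_by have := List.sizeOf_lt_of_mem c.2; simp only [PTree.node.sizeOf_spec] at *; omega

def PTree.countDepth : PTree → ℕ → ℕ
  | .node _, 0 => 1
  | .node cs, d + 1 => (cs.attach.map fun c => PTree.countDepth c.1 d).sum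
termination_by t _ => sizeOf t
decreasing_by have := List.sizeOf_lt_of_mem c.2; simp only [PTree.node.sizeOf_spec] at *; omega

/-- Value of a path after the steps in `l` (`true` = up-step, `false` = down-step). -/
def pathVal (l : List Bool) : ℤ := (l.map fun b => if b then (1 : ℤ) else -1).sum

/-- `l` is a Dyck path. -/
def IsDyckPath (l : List Bool) : Prop :=
  pathVal l = 0 ∧ ∀ p, p <+: l → 0 ≤ pathVal p

/-- The height of the path `l` is exactly `H`. -/
def DyckHeightIs (l : List Bool) (H : ℕ) : Prop :=
  (∃ p, p <+: l ∧ pathVal p = H) ∧ ∀ p, p <+: l → pathVal p ≤ (H : ℤ)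

/-- Number of peaks of a path. -/
def peaks (l : List Bool) : ℕ :=
  ((List.range l.length).filter fun i => l.getD i false && !(l.getD (i + 1) true)).length


theorem HasChainAbove.hasChain {α : Type*} [Preorder α] {a : α} {k : ℕ}
    (h : HasChainAbove a k) : HasChain α (k + 1) := by
  obtain ⟨c, hc, hac⟩ := h
  refine ⟨Fin.cons a c, fun x y hxy => ?_⟩
  induction y using Fin.cases with
  | zero => exact absurd hxy (Fin.not_lt_zero x)
  | succ y =>
    induction x using Fin.cases with
    | zero => simpa using hac y
    | succ x => simpa using hc (Fin.succ_lt_succ_iff.mp hxy)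

theorem HasChain.exists_hasChainAbove {α : Type*} [Preorder α] {k : ℕ}
    (h : HasChain α (k + 1)) : ∃ a : α, HasChainAbove a k := by
  obtain ⟨c, hc⟩ := h
  exact ⟨c 0, fun j => c j.succ, fun _ _ hxy => hc (Fin.succ_lt_succ_iff.mpr hxy),
    fun j => hc (Fin.succ_pos j)⟩

theorem HasChainAbove.of_lt {α : Type*} [Preorder α] {a b : α} {k : ℕ}
    (h : HasChainAbove b k) (hab : a < b) : HasChainAbove a (k + 1) := by
  obtain ⟨c, hc, hbc⟩ := h
  refine ⟨Fin.cons b c, fun x y hxy => ?_, fun j => ?_⟩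
  · induction y using Fin.cases with
    | zero => exact absurd hxy (Fin.not_lt_zero x)
    | succ y =>
      induction x using Fin.cases with
      | zero => simpa using hbc y
      | succ x => simpa using hc (Fin.succ_lt_succ_iff.mp hxy)
  · induction j using Fin.cases with
    | zero => simpa using hab
    | succ j => simpa using hab.trans (hbc j)

theorem HasChainAbove.exists_lt {α : Type*} [Preorder α] {a : α} {k : ℕ}
    (h : HasChainAbove a (k + 1)) : ∃ b, a < b ∧ HasChainAbove b k := by
  obtain ⟨c, hc, hac⟩ := h
  exact ⟨c 0, hac 0, fun j => c j.succ, fun _ _ hxy => hc (Fin.succ_lt_succ_iff.mpr hxy),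
    fun j => hc (Fin.succ_pos j)⟩

theorem OnLevel.not_lt {α : Type*} [Preorder α] {a b : α} {k : ℕ}
    (ha : OnLevel a k) (hb : OnLevel b k) : ¬ a < b := by
  intro hab
  have h := hb.2.1.of_lt hab
  rw [Nat.sub_add_cancel ha.1] at h
  exact ha.2.2 h

theorem OnLevel.exists_lt {α : Type*} [Preorder α] {b : α} {k : ℕ} (hk : 1 ≤ k)
    (hb : OnLevel b (k + 1)) : ∃ c, b < c ∧ OnLevel c k := by
  obtain ⟨m, rfl⟩ := Nat.exists_eq_add_of_le' hk
  obtain ⟨c, hbc, hc⟩ := HasChainAbove.exists_lt (k := m) hb.2.1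
  exact ⟨c, hbc, hk, hc, fun h => hb.2.2 (h.of_lt hbc)⟩

theorem HasLength.exists_onLevel {α : Type*} [Preorder α] {H i : ℕ} (h : HasLength α H)
    (hi : 1 ≤ i) (hiH : i ≤ H + 1) : ∃ a : α, OnLevel a i := by
  induction hiH using Nat.decreasingInduction with
  | self =>
    obtain ⟨a, ha⟩ := h.1.exists_hasChainAbove
    exact ⟨a, hi, ha, fun h' => h.2 h'.hasChain⟩
  | of_succ k _ ih =>
    obtain ⟨b, hb⟩ := ih (Nat.le_add_left 1 k)
    obtain ⟨c, -, hc⟩ := hb.exists_lt hi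
    exact ⟨c, hc⟩

theorem statement0 {α : Type*} [Fintype α] [PartialOrder α] (H : ℕ)
    (hsemi : IsSemiorder α) (hlen : HasLength α H) (i : ℕ) (hi1 : 1 ≤ i) (hiH : i ≤ H) :
    ∃ a : α, OnLevel a i ∧ ∀ b : α, OnLevel b (i + 1) → b < a := by
  obtain ⟨a, ha, hmax⟩ := (Set.toFinite {a : α | OnLevel a i}).exists_maximalFor
    (fun a => {b : α | OnLevel b (i + 1) ∧ b < a}) _
    (hlen.exists_onLevel hi1 (hiH.trans (Nat.le_succ H)))
  refine ⟨a, ha, fun b hb => ?_⟩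
  by_contra hba
  obtain ⟨c, hbc, hc⟩ := hb.exists_lt hi1
  obtain ⟨d, hd, hda, hdc⟩ : ∃ d, OnLevel d (i + 1) ∧ d < a ∧ ¬ d < c := by
    by_contra! hcon
    exact hba (hmax hc (fun d hd => ⟨hd.1, hcon d hd.1 hd.2⟩) ⟨hb, hbc⟩).2
  have key : ∀ {u v w : α}, OnLevel u i → OnLevel v i → w < v → ¬ w < u → Incomp u w := by
    intro u v w hu hv hwv hwu
    have huw : ¬ u ≤ w := fun h => hu.not_lt hv (h.trans_lt hwv)
    exact ⟨huw, fun h => hwu (lt_of_le_not_ge h huw)⟩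
  refine hsemi.1 ⟨a, d, c, b, hda, hbc, ?_, key ha hc hbc hba, (key hc ha hda hdc).symm, ?_⟩
  · exact ⟨fun h => hdc (hda.trans_le h), fun h => hba (hbc.trans_le h)⟩
  · exact ⟨fun h => hdc (h.trans_lt hbc), fun h => hba (h.trans_lt hda)⟩

end Paper
end

section
/- For every n ≥ 1 and H ≥ 0, the number of nonisomorphic n-element semiorders of length H equals the number of (n+1)-node ordered trees of height H+1. -/
namespace Paper

theorem PTree.size_node (cs : List PTree) :
    (PTree.node cs).size = 1 + (cs.map PTree.size).sum := by
  rw [PTree.size]; simp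

theorem PTree.height_node (cs : List PTree) :
    (PTree.node cs).height = (cs.map fun c => c.height + 1).foldr max 0 := by
  rw [PTree.height]; simp

/-- The sequence `l` lists, in breadth-first order, the positions of the parents of all non-root
nodes of the forest `q`; the roots of `q` have the first positions, counted from `0`. -/
inductive IsParentSeq : List PTree → List ℕ → Prop
  | nil : IsParentSeq [] []
  | pop {q l} : IsParentSeq q l → IsParentSeq (.node [] :: q) (l.map Nat.succ)
  | child {c cs q l} : IsParentSeq (.node cs :: (q ++ [c])) l →
      IsParentSeq (.node (c :: cs) :: q) (0 :: l)

/-- Each entry of the sequence is less than `m` plus its index. -/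
def EntriesLt : ℕ → List ℕ → Prop
  | _, [] => True
  | m, x :: l => x < m ∧ EntriesLt (m + 1) l

/-- Extend a list of depths of nodes by the depths of nodes with the given parent positions. -/
def extendDepths : List ℕ → List ℕ → List ℕ
  | e, [] => e
  | e, x :: l => extendDepths (e ++ [e.getD x 0 + 1]) l

theorem entriesLt_map_succ (m : ℕ) (l : List ℕ) :
    EntriesLt (m + 1) (l.map Nat.succ) ↔ EntriesLt m l := by
  induction l generalizing m with
  | nil => simp [EntriesLt]
  | cons x l ih => simp [EntriesLt, ih]

theorem entriesLt_iff (m : ℕ) (l : List ℕ) :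
    EntriesLt m l ↔ ∀ k (hk : k < l.length), l[k] < m + k := by
  induction l generalizing m with
  | nil => simp [EntriesLt]
  | cons x l ih =>
    simp only [EntriesLt, ih]
    constructor
    · rintro ⟨h0, h⟩ k hk
      cases k with
      | zero => simpa using h0
      | succ k =>
        have := h k (by simpa using hk)
        simp only [List.getElem_cons_succ]
        omega
    · intro h
      refine ⟨h 0 (by simp), fun k hk => ?_⟩
      have := h (k + 1) (by simpa using hk)
      simp only [List.getElem_cons_succ] at this
      omega

theorem extendDepths_map_succ (a : ℕ) (e l : List ℕ) :
    extendDepths (a :: e) (l.map Nat.succ) = a :: extendDepths e l := by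
  induction l generalizing e with
  | nil => rfl
  | cons x l ih =>
    simp only [List.map_cons, extendDepths, List.cons_append, Nat.succ_eq_add_one,
      List.getD_cons_succ]
    exact ih _

theorem length_extendDepths (e l : List ℕ) :
    (extendDepths e l).length = e.length + l.length := by
  induction l generalizing e with
  | nil => rfl
  | cons x l ih => simp only [extendDepths, ih, List.length_append, List.length_cons,
      List.length_nil]; omega

theorem getD_extendDepths_of_lt (e l : List ℕ) {x : ℕ} (hx : x < e.length) :
    (extendDepths e l).getD x 0 = e.getD x 0 := by
  induction l generalizing e with
  | nil => rfl
  | cons y l ih =>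
    rw [extendDepths, ih _ (by simp; omega), List.getD_append _ _ _ _ hx]

theorem getD_extendDepths_add (e l : List ℕ) (hl : EntriesLt e.length l) {k : ℕ}
    (hk : k < l.length) :
    (extendDepths e l).getD (e.length + k) 0 = (extendDepths e l).getD l[k] 0 + 1 := by
  induction l generalizing e k with
  | nil => simp at hk
  | cons y l ih =>
    obtain ⟨hy, hl⟩ := hl
    rw [extendDepths]
    cases k with
    | zero =>
      simp only [List.getElem_cons_zero, Nat.add_zero]
      rw [getD_extendDepths_of_lt _ _ (by simp), getD_extendDepths_of_lt _ _ (by simp; omega),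
        List.getD_append _ _ _ _ hy, List.getD_append_right _ _ _ _ le_rfl]
      simp
    | succ k =>
      have := ih (e ++ [e.getD y 0 + 1]) (by simpa using hl) (k := k) (by simpa using hk)
      simp only [List.length_append, List.length_cons, List.length_nil] at this
      simp only [List.getElem_cons_succ]
      rw [← this]
      congr 1
      omega

theorem foldr_max_append (l₁ l₂ : List ℕ) :
    (l₁ ++ l₂).foldr max 0 = max (l₁.foldr max 0) (l₂.foldr max 0) := by
  induction l₁ with
  | nil => simp
  | cons x l ih => simp [ih, max_assoc]

theorem lt_foldr_max_iff (l : List ℕ) (k : ℕ) : k < l.foldr max 0 ↔ ∃ x ∈ l, k < x := by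
  induction l with
  | nil => simp
  | cons x l ih => simp [ih]

theorem length_le_sum_size (q : List PTree) : q.length ≤ (q.map PTree.size).sum := by
  induction q with
  | nil => simp
  | cons t q ih =>
    obtain ⟨cs⟩ := t
    simp [PTree.size_node]
    omega

namespace IsParentSeq

theorem exists_seq (q : List PTree) : ∃ l, IsParentSeq q l := by
  match q with
  | [] => exact ⟨_, nil⟩
  | .node [] :: q =>
    obtain ⟨l, h⟩ := exists_seq q
    exact ⟨_, pop h⟩
  | .node (c :: cs) :: q =>
    obtain ⟨l, h⟩ := exists_seq (.node cs :: (q ++ [c]))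
    exact ⟨_, child h⟩
termination_by 2 * (q.map PTree.size).sum - q.length
decreasing_by
  all_goals
    have := length_le_sum_size q
    simp [PTree.size_node]
    omega

theorem length_add {q : List PTree} {l : List ℕ} (h : IsParentSeq q l) :
    l.length + q.length = (q.map PTree.size).sum := by
  induction h with
  | nil => rfl
  | pop h ih => simp [PTree.size_node]; omega
  | child h ih => simp [PTree.size_node] at ih ⊢; omega

theorem pairwise {q : List PTree} {l : List ℕ} (h : IsParentSeq q l) : l.Pairwise (· ≤ ·) := by
  induction h with
  | nil => simp
  | pop h ih => simpa [List.pairwise_map] using ih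
  | child h ih => simpa using ih

theorem entriesLt {q : List PTree} {l : List ℕ} (h : IsParentSeq q l) :
    EntriesLt q.length l := by
  induction h with
  | nil => trivial
  | pop h ih => simpa [entriesLt_map_succ] using ih
  | child h ih => exact ⟨by simp, by simpa using ih⟩

theorem foldr_max {q : List PTree} {l : List ℕ} (h : IsParentSeq q l) (e : List ℕ)
    (he : e.length = q.length) :
    (extendDepths e l).foldr max 0 =
      (List.zipWith (fun a t => a + t.height) e q).foldr max 0 := by
  induction h generalizing e with
  | nil => obtain rfl := List.length_eq_zero_iff.1 he; rfl
  | pop h ih =>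
    obtain ⟨a, e, rfl⟩ := List.exists_cons_of_length_eq_add_one he
    rw [extendDepths_map_succ]
    simp [ih e (by simpa using he), PTree.height_node]
  | child h ih =>
    obtain ⟨a, e, rfl⟩ := List.exists_cons_of_length_eq_add_one he
    have he' := Nat.succ.inj he
    rw [extendDepths, ih _ (by simp [he']), List.cons_append, List.zipWith_cons_cons,
      List.zipWith_append he']
    simp only [List.zipWith_cons_cons, List.foldr_cons, foldr_max_append, PTree.height_node]
    simp
    omega

theorem seq_unique {q : List PTree} {l l' : List ℕ} (h : IsParentSeq q l)
    (h' : IsParentSeq q l') : l = l' := by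
  induction h generalizing l' with
  | nil => cases h'; rfl
  | pop h ih => cases h' with | pop h' => rw [ih h']
  | child h ih => cases h' with | child h' => rw [ih h']

theorem forest_unique {q q' : List PTree} {l : List ℕ} (h : IsParentSeq q l)
    (h' : IsParentSeq q' l) (hq : q.length = q'.length) : q = q' := by
  induction h generalizing q' with
  | nil => exact (List.length_eq_zero_iff.1 hq.symm).symm
  | @pop q l h ih =>
    generalize hl : l.map Nat.succ = l₀ at h'
    cases h' with
    | nil => simp at hq
    | pop h' =>
      obtain rfl := (List.map_injective_iff.2 Nat.succ_injective) hl
      rw [ih h' (by simpa using hq)]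
    | child h' => cases l <;> simp at hl
  | @child c cs q l h ih =>
    generalize hl : 0 :: l = l₀ at h'
    cases h' with
    | nil => simp at hl
    | @pop _ l' h' => cases l' <;> simp at hl
    | child h' =>
      obtain rfl := (List.cons.inj hl).2
      have := ih h' (by simpa using hq)
      simp only [List.cons.injEq, PTree.node.injEq] at this
      obtain ⟨rfl, h2⟩ := this
      obtain ⟨rfl, h3⟩ := List.append_inj' h2 rfl
      simp at h3
      rw [h3]

theorem exists_forest (m : ℕ) (l : List ℕ) (hs : l.Pairwise (· ≤ ·)) (hl : EntriesLt m l) :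
    ∃ q, q.length = m ∧ IsParentSeq q l := by
  match m, l with
  | 0, [] => exact ⟨_, rfl, nil⟩
  | 0, x :: l => exact absurd hl.1 (by simp)
  | m + 1, 0 :: l =>
    obtain ⟨q, hq, h⟩ := exists_forest (m + 2) l hs.of_cons hl.2
    obtain ⟨⟨cs⟩, q, rfl⟩ := List.exists_cons_of_length_eq_add_one hq
    have hq' : q.length = m + 1 := by simpa using hq
    rcases List.eq_nil_or_concat q with rfl | ⟨q, c, rfl⟩
    · simp at hq'
    · rw [List.concat_eq_append] at h hq'
      exact ⟨.node (c :: cs) :: q, by simpa using hq', child h⟩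
  | m + 1, [] =>
    obtain ⟨q, hq, h⟩ := exists_forest m [] .nil trivial
    exact ⟨_, by simpa using hq, pop h⟩
  | m + 1, (x + 1) :: l =>
    have hx : ((x + 1) :: l) = (x :: l.map Nat.pred).map Nat.succ := by
      rw [List.map_cons, List.map_map, List.cons.injEq]
      refine ⟨rfl, ?_⟩
      conv_lhs => rw [← List.map_id l]
      refine List.map_congr_left fun y hy => ?_
      have := List.rel_of_pairwise_cons hs hy
      simp; omega
    rw [hx] at hs hl ⊢
    obtain ⟨q, hq, h⟩ := exists_forest m (x :: l.map Nat.pred)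
      (by simpa [List.pairwise_map] using hs) ((entriesLt_map_succ _ _).1 hl)
    exact ⟨_, by simpa using hq, pop h⟩
termination_by m + 2 * l.length

end IsParentSeq

theorem incomp_iff {α : Type*} [PartialOrder α] {a b : α} :
    Incomp a b ↔ ¬ a < b ∧ ¬ b < a ∧ a ≠ b := by
  simp only [Incomp, le_iff_lt_or_eq]
  grind

/-- The enumeration `σ` of a poset identifies the strict down-set of its `i`-th element with the
first `f i` elements. -/
def IsCoding {α : Type*} [PartialOrder α] {n : ℕ} (f : Fin n → ℕ) (σ : Fin n ≃ α) : Prop :=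
  ∀ i j, σ i < σ j ↔ (i : ℕ) < f j

/-- The partial order on `Fin n` in which the elements below `j` are the first `f j` ones. -/
abbrev codeOrder {n : ℕ} (f : Fin n → ℕ) (hle : ∀ i, f i ≤ i) :
    PartialOrder (Fin n) where
  le i j := i = j ∨ (i : ℕ) < f j
  lt i j := (i : ℕ) < f j
  lt_iff_le_not_ge i j := by
    have := hle i
    have := hle j
    constructor
    · intro h
      refine ⟨.inr h, ?_⟩
      rintro (rfl | h') <;> omega
    · rintro ⟨rfl | h, h'⟩
      · simp at h'
      · exact h
  le_refl _ := .inl rfl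
  le_trans i j k := by
    rintro (rfl | hij) (rfl | hjk)
    · exact .inl rfl
    · exact .inr hjk
    · exact .inr hij
    · have := hle j
      have := hle k
      exact .inr (by omega)
  le_antisymm i j := by
    have := hle i
    have := hle j
    rintro (rfl | hij) (h | hji)
    · rfl
    · rfl
    · exact h.symm
    · omega

theorem isCoding_codeOrder {n : ℕ} (f : Fin n → ℕ) (hle : ∀ i, f i ≤ i) :
    @IsCoding (Fin n) (codeOrder f hle) n f (Equiv.refl _) :=
  fun _ _ => Iff.rfl

theorem monotoneOn_depth {n : ℕ} {f : Fin n → ℕ} (hf : Monotone f) (hle : ∀ i, f i ≤ i)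
    {d : ℕ → ℕ} (hd0 : d 0 = 0) (hdf : ∀ i : Fin n, d (i + 1) = d (f i) + 1) {x y : ℕ}
    (hy : y ≤ n) (hxy : x ≤ y) : d x ≤ d y := by
  induction y using Nat.strong_induction_on generalizing x with
  | _ y ih =>
    rcases x with _ | i
    · simp [hd0]
    · obtain ⟨j, rfl⟩ : ∃ j, y = j + 1 := ⟨y - 1, by omega⟩
      have hi := hdf ⟨i, by omega⟩
      have hj := hdf ⟨j, by omega⟩
      simp only at hi hj
      rw [hi, hj]
      have hjn := hle ⟨j, by omega⟩
      simp only at hjn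
      exact Nat.succ_le_succ (ih _ (by omega) (by omega) (hf (Fin.mk_le_mk.2 (by omega))))

namespace IsCoding

variable {α : Type*} [PartialOrder α] {n : ℕ} {f : Fin n → ℕ} {σ : Fin n ≃ α}

theorem isSemiorder (h : IsCoding f σ) (hf : Monotone f) : IsSemiorder α := by
  constructor
  · rintro ⟨x, y, z, w, hyx, hwz, -, ⟨-, hwx⟩, ⟨hyz, -⟩, -⟩
    obtain ⟨x, rfl⟩ := σ.surjective x
    obtain ⟨y, rfl⟩ := σ.surjective y
    obtain ⟨z, rfl⟩ := σ.surjective z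
    obtain ⟨w, rfl⟩ := σ.surjective w
    have hyz' := mt (h y z).2 fun h => hyz h.le
    have hwx' := mt (h w x).2 fun h => hwx h.le
    rw [h] at hyx hwz
    omega
  · rintro ⟨x, y, z, w, hzy, hyx, ⟨-, hwx⟩, -, ⟨hzw, -⟩⟩
    obtain ⟨x, rfl⟩ := σ.surjective x
    obtain ⟨y, rfl⟩ := σ.surjective y
    obtain ⟨z, rfl⟩ := σ.surjective z
    obtain ⟨w, rfl⟩ := σ.surjective w
    have hwx' := mt (h w x).2 fun h => hwx h.le
    have hzw' := mt (h z w).2 fun h => hzw h.le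
    rw [h] at hyx hzy
    have : f y ≤ f w := hf (Fin.le_def.2 (by omega))
    omega

theorem card_lt [Fintype α] [DecidableLT α] (h : IsCoding f σ) (hle : ∀ i, f i ≤ i)
    (i : Fin n) : (Finset.univ.filter (· < σ i)).card = f i := by
  have : Finset.univ.filter (· < σ i) =
      (Finset.univ.filter fun j : Fin n => (j : ℕ) < f i).map σ.toEmbedding := by
    ext a
    obtain ⟨a, rfl⟩ := σ.surjective a
    simp [h a i]
  rw [this, Finset.card_map, Fin.card_filter_val_lt]
  have := hle i
  omega

theorem hasChain_iff (h : IsCoding f σ) (hf : Monotone f) (hle : ∀ i, f i ≤ i) {d : ℕ → ℕ}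
    (hd0 : d 0 = 0) (hdf : ∀ i : Fin n, d (i + 1) = d (f i) + 1) (k : ℕ) :
    HasChain α (k + 1) ↔ ∃ i : Fin n, k < d (i + 1) := by
  constructor
  · rintro ⟨c, hc⟩
    suffices H : ∀ m (hm : m < k + 1), m < d (σ.symm (c ⟨m, hm⟩) + 1) from ⟨_, H k (by omega)⟩
    intro m
    induction m with
    | zero => intro hm; rw [hdf]; omega
    | succ m ih =>
      intro hm
      have h1 : c ⟨m, by omega⟩ < c ⟨m + 1, hm⟩ := hc (by simp)
      rw [← σ.apply_symm_apply (c ⟨m, _⟩), ← σ.apply_symm_apply (c ⟨m + 1, _⟩), h] at h1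
      have h2 := ih (by omega)
      have h3 := monotoneOn_depth hf hle hd0 hdf
        ((hle _).trans (Fin.is_lt _).le) (Nat.succ_le_of_lt h1)
      rw [hdf]
      simp only [Nat.succ_eq_add_one] at h3
      omega
  · rintro ⟨i, hi⟩
    suffices H : ∀ k (i : Fin n), k ≤ d (i + 1) →
        ∃ c : Fin k → α, StrictMono c ∧ ∀ j, c j ≤ σ i by
      obtain ⟨c, hc, -⟩ := H (k + 1) i hi
      exact ⟨c, hc⟩
    intro k
    induction k with
    | zero => exact fun i _ => ⟨Fin.elim0, fun i => i.elim0, fun i => i.elim0⟩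
    | succ k ih =>
      intro i hi
      rw [hdf] at hi
      obtain ⟨c, hc, hci⟩ : ∃ c : Fin k → α, StrictMono c ∧ ∀ j, c j < σ i := by
        rcases Nat.eq_zero_or_pos (f i) with h0 | h0
        · rw [h0, hd0] at hi
          obtain rfl : k = 0 := by omega
          exact ⟨Fin.elim0, fun i => i.elim0, fun i => i.elim0⟩
        · have := hle i
          obtain ⟨c, hc, hci⟩ := ih ⟨f i - 1, by omega⟩ (by
            simp only [Nat.sub_add_cancel h0]; omega)
          exact ⟨c, hc, fun j => (hci j).trans_lt ((h _ _).2 (Nat.sub_lt h0 one_pos))⟩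
      refine ⟨Fin.snoc (α := fun _ => α) c (σ i), ?_, ?_⟩
      · intro a b
        refine Fin.lastCases ?_ (fun b => ?_) b <;> refine Fin.lastCases ?_ (fun a => ?_) a
        · simp
        · simpa [Fin.castSucc_lt_last] using hci a
        · intro h'; exact absurd (Fin.le_last _) h'.not_ge
        · simpa using fun h' => hc h'
      · intro j
        refine Fin.lastCases ?_ (fun j => ?_) j
        · simp
        · simpa using (hci j).le

theorem hasLength_iff (h : IsCoding f σ) (hf : Monotone f) (hle : ∀ i, f i ≤ i) (H : ℕ) :
    HasLength α H ↔ (extendDepths [0] (List.ofFn f)).foldr max 0 = H + 1 := by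
  let d : ℕ → ℕ := fun x => (extendDepths [0] (List.ofFn f)).getD x 0
  have hlen : (extendDepths [0] (List.ofFn f)).length = 1 + n := by
    simp [length_extendDepths]
  have hd0 : d 0 = 0 := getD_extendDepths_of_lt [0] _ one_pos
  have hdf : ∀ i : Fin n, d (i + 1) = d (f i) + 1 := by
    intro i
    have hl : EntriesLt [0].length (List.ofFn f) := by
      rw [entriesLt_iff]
      intro k hk
      have := hle ⟨k, by simpa using hk⟩
      simp only [List.getElem_ofFn, List.length_singleton]
      simp only at this
      omega
    have := getD_extendDepths_add [0] (List.ofFn f) hl (k := i) (by simp)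
    rw [List.getElem_ofFn, List.length_singleton, add_comm] at this
    exact this
  have key : ∀ k, HasChain α (k + 1) ↔ k < (extendDepths [0] (List.ofFn f)).foldr max 0 := by
    intro k
    rw [h.hasChain_iff hf hle hd0 hdf, lt_foldr_max_iff]
    constructor
    · rintro ⟨i, hi⟩
      refine ⟨_, ?_, hi⟩
      rw [show d (i + 1) = _ from List.getD_eq_getElem _ _ (by rw [hlen]; omega)]
      exact List.getElem_mem _
    · rintro ⟨x, hx, hk⟩
      obtain ⟨i, hi, rfl⟩ := List.mem_iff_getElem.1 hx
      rw [← List.getD_eq_getElem _ 0] at hk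
      rcases i with _ | i
      · exact absurd (hk.trans_eq hd0) (Nat.not_lt_zero _)
      · exact ⟨⟨i, by omega⟩, hk⟩
  rw [HasLength, key, key]
  omega

end IsCoding

theorem HasChain.of_strictMono {α β : Type*} [Preorder α] [Preorder β] {g : α → β}
    (hg : StrictMono g) {k : ℕ} : HasChain α k → HasChain β k
  | ⟨c, hc⟩ => ⟨g ∘ c, hg.comp hc⟩

theorem IsSemiorder.exists_isCoding {α : Type*} [PartialOrder α] [Fintype α]
    (h : IsSemiorder α) {n : ℕ} (hn : Fintype.card α = n) :
    ∃ (f : Fin n → ℕ) (σ : Fin n ≃ α), Monotone f ∧ (∀ i, f i ≤ i) ∧ IsCoding f σ := by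
  classical
  obtain ⟨h22, h31⟩ := h
  let D : α → Finset α := fun x => Finset.univ.filter (· < x)
  let U : α → Finset α := fun x => Finset.univ.filter (x < ·)
  have hD : ∀ x y, D x ⊆ D y ∨ D y ⊆ D x := by
    intro x y
    by_contra! hxy
    simp only [Finset.not_subset, D, Finset.mem_filter_univ] at hxy
    obtain ⟨⟨a, hax, hay⟩, ⟨b, hby, hbx⟩⟩ := hxy
    refine h22 ⟨x, a, y, b, hax, hby, ?_, ?_, ?_, ?_⟩ <;>
      clear h22 h31 <;> rw [incomp_iff] <;> grind
  have hU : ∀ x y, U x ⊆ U y ∨ U y ⊆ U x := by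
    intro x y
    by_contra! hxy
    simp only [Finset.not_subset, U, Finset.mem_filter_univ] at hxy
    obtain ⟨⟨a, hax, hay⟩, ⟨b, hby, hbx⟩⟩ := hxy
    refine h22 ⟨a, x, b, y, hax, hby, ?_, ?_, ?_, ?_⟩ <;>
      clear h22 h31 hD <;> rw [incomp_iff] <;> grind
  have hDU : ∀ x y, D y ⊆ D x ∨ U y ⊆ U x := by
    intro x y
    by_contra! hxy
    simp only [Finset.not_subset, D, U, Finset.mem_filter_univ] at hxy
    obtain ⟨⟨a, hay, hax⟩, ⟨b, hyb, hxb⟩⟩ := hxy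
    refine h31 ⟨b, y, a, x, hay, hyb, ?_, ?_, ?_⟩ <;>
      clear h22 h31 hD hU <;> rw [incomp_iff] <;> grind
  let κ : α → ℤ := fun x => (D x).card - (U x).card
  have hκ : ∀ x y, κ x ≤ κ y → D x ⊆ D y ∧ U y ⊆ U x := by
    intro x y hxy
    have key : ∀ s t : Finset α, s ⊆ t → s.card ≤ t.card ∧ (t ⊆ s ∨ s.card < t.card) := by
      intro s t hst
      refine ⟨Finset.card_le_card hst, ?_⟩
      by_cases hts : t ⊆ s
      · exact .inl hts
      · exact .inr (Finset.card_lt_card ⟨hst, hts⟩)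
    have k1 := key (D x) (D y)
    have k2 := key (D y) (D x)
    have k3 := key (U x) (U y)
    have k4 := key (U y) (U x)
    have := hD x y
    have := hU x y
    have := hDU x y
    have := hDU y x
    simp only [κ] at hxy
    constructor <;> by_contra hc <;> grind
  let τ : Fin n ≃ α := (Fintype.equivFinOfCardEq hn).symm
  let σ : Fin n ≃ α := (Tuple.sort (κ ∘ τ)).trans τ
  have hσ : Monotone (κ ∘ σ) := Tuple.monotone_sort (κ ∘ τ)
  have hσD : ∀ i j : Fin n, i ≤ j → D (σ i) ⊆ D (σ j) ∧ U (σ j) ⊆ U (σ i) :=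
    fun i j hij => hκ _ _ (hσ hij)
  have hcard : ∀ i, (D (σ i)).card = (Finset.univ.filter fun j => σ j < σ i).card := by
    intro i
    rw [← Finset.card_map σ.toEmbedding]
    congr 1
    ext a
    obtain ⟨a, rfl⟩ := σ.surjective a
    simp [D]
  have hlt : ∀ i j, σ i < σ j → i < j := by
    intro i j hij
    by_contra! hji
    have := (hσD j i hji).1 (Finset.mem_filter_univ _ |>.2 hij : σ i ∈ D (σ j))
    simp [D] at this
  have hlower : ∀ i j k, k ≤ j → σ j < σ i → σ k < σ i := by
    intro i j k hkj hji
    have := (hσD k j hkj).2 (Finset.mem_filter_univ _ |>.2 hji : σ i ∈ U (σ j))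
    simpa [U] using this
  refine ⟨fun i => (D (σ i)).card, σ, fun i j hij => Finset.card_le_card (hσD i j hij).1,
    fun i => ?_, fun i j => ?_⟩
  · dsimp only
    rw [hcard]
    refine (Finset.card_le_card (t := Finset.Iio i) fun j hj => ?_).trans (by simp)
    simpa using hlt _ _ (by simpa using hj)
  · dsimp only
    rw [hcard]
    constructor
    · intro hij
      have : (Finset.Iic i).card ≤ (Finset.univ.filter fun k => σ k < σ j).card :=
        Finset.card_le_card fun k hk => by
          simpa using hlower j i k (by simpa using hk) hij
      simp at this
      omega
    · intro hij
      by_contra hc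
      have : (Finset.univ.filter fun k => σ k < σ j).card ≤ (Finset.Iio i).card :=
        Finset.card_le_card fun k hk => by
          simp only [Finset.mem_filter_univ, Finset.mem_Iio] at hk ⊢
          by_contra! hik
          exact hc (hlower j k i hik hk)
      simp at this
      omega

/-- Monotone sequences with `i`-th term at most `i` whose poset has length `H`. -/
abbrev CodeSeq (n H : ℕ) : Type :=
  {f : Fin n → ℕ // Monotone f ∧ (∀ i, f i ≤ i) ∧
    (extendDepths [0] (List.ofFn f)).foldr max 0 = H + 1}

theorem eq_of_perm_of_monotone {n : ℕ} {f g : Fin n → ℕ} (hf : Monotone f) (hg : Monotone g)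
    (h : (Finset.univ.val.map f) = Finset.univ.val.map g) : f = g := by
  apply List.ofFn_injective
  refine List.Perm.eq_of_sortedLE hf.sortedLE_ofFn hg.sortedLE_ofFn ?_
  rw [← Multiset.coe_eq_coe, List.ofFn_eq_map, List.ofFn_eq_map]
  simpa [Fin.univ_def] using h

open Classical in
/-- The multiset of sizes of the strict down-sets of the elements of a finite poset. -/
noncomputable def downCards (α : Type*) [PartialOrder α] [Fintype α] : Multiset ℕ :=
  Finset.univ.val.map fun a : α => (Finset.univ.filter (· < a)).card

theorem IsCoding.downCards_eq {α : Type*} [PartialOrder α] [Fintype α] {n : ℕ}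
    {f : Fin n → ℕ} {σ : Fin n ≃ α} (h : IsCoding f σ) (hle : ∀ i, f i ≤ i) :
    downCards α = Finset.univ.val.map f := by
  classical
  have hu : (Finset.univ : Finset α).val = Finset.univ.val.map σ := by
    rw [← Finset.map_univ_equiv σ, Finset.map_val]; rfl
  rw [downCards, hu, Multiset.map_map]
  exact Multiset.map_congr rfl fun i _ => h.card_lt hle i

theorem downCards_congr {α β : Type*} [PartialOrder α] [PartialOrder β] [Fintype α] [Fintype β]
    (e : α ≃o β) : downCards α = downCards β := by
  classical
  have hu : (Finset.univ : Finset β).val = Finset.univ.val.map e := by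
    rw [← Finset.map_univ_equiv e.toEquiv, Finset.map_val]; rfl
  rw [downCards, downCards, hu, Multiset.map_map]
  refine Multiset.map_congr rfl fun a _ => ?_
  rw [← Finset.card_map e.toEquiv.toEmbedding]
  simp only [Function.comp_apply]
  congr 1
  ext b
  obtain ⟨b, rfl⟩ := e.surjective b
  simp

theorem card_codeSeq_eq_fEx (n H : ℕ) : Nat.card (CodeSeq n H) = fEx H n := by
  classical
  let toPoset : CodeSeq n H → {P : PartialOrder (Fin n) // SemiLen n H P} := fun f =>
    ⟨codeOrder f.1 f.2.2.1,
      @IsCoding.isSemiorder _ (codeOrder f.1 f.2.2.1) _ _ _ (isCoding_codeOrder _ _) f.2.1,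
      (@IsCoding.hasLength_iff _ (codeOrder f.1 f.2.2.1) _ _ _ (isCoding_codeOrder _ _) f.2.1
        f.2.2.1 H).2 f.2.2.2⟩
  refine Nat.card_eq_of_bijective (fun f => Quot.mk _ (toPoset f)) ⟨fun f g hfg => ?_, fun P => ?_⟩
  · refine Subtype.ext (eq_of_perm_of_monotone f.2.1 g.2.1 ?_)
    have hinv := congrArg (Quot.lift (fun P : {P : PartialOrder (Fin n) // SemiLen n H P} =>
      @downCards (Fin n) P.1 _) ?_) hfg
    · have hf := @IsCoding.downCards_eq _ (codeOrder f.1 f.2.2.1) _ _ _ _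
        (isCoding_codeOrder _ _) f.2.2.1
      have hg := @IsCoding.downCards_eq _ (codeOrder g.1 g.2.2.1) _ _ _ _
        (isCoding_codeOrder _ _) g.2.2.1
      exact hf.symm.trans (hinv.trans hg)
    · rintro ⟨P, _⟩ ⟨Q, _⟩ ⟨e, he⟩
      exact @downCards_congr _ _ P Q _ _
        (@RelIso.mk _ _ P.le Q.le e fun {a b} => (he a b).symm)
  · obtain ⟨⟨P, hs, hl⟩, rfl⟩ := Quot.exists_rep P
    obtain ⟨f, σ, hf, hle, hσ⟩ := @IsSemiorder.exists_isCoding _ P _ hs n (Fintype.card_fin n)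
    refine ⟨⟨f, hf, hle, (@IsCoding.hasLength_iff _ P _ _ _ hσ hf hle H).1 hl⟩,
      Quot.sound ⟨σ, fun a b => ?_⟩⟩
    change (a = b ∨ (a : ℕ) < f b) ↔ P.le (σ a) (σ b)
    rw [@le_iff_lt_or_eq _ P, hσ a b, σ.injective.eq_iff, or_comm]

theorem card_codeSeq_eq_card_trees (n H : ℕ) :
    Nat.card (CodeSeq n H) = Nat.card {tr : PTree // tr.size = n + 1 ∧ tr.height = H + 1} := by
  have hex : ∀ f : CodeSeq n H, ∃ t : PTree, IsParentSeq [t] (List.ofFn f.1) := by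
    intro f
    obtain ⟨q, hq, h⟩ := IsParentSeq.exists_forest 1 (List.ofFn f.1)
      f.2.1.sortedLE_ofFn.pairwise ((entriesLt_iff _ _).2 fun k hk => by
        have := f.2.2.1 ⟨k, by simpa using hk⟩
        simp only at this
        rw [List.getElem_ofFn]
        omega)
    obtain ⟨t, rfl⟩ := List.length_eq_one_iff.1 hq
    exact ⟨t, h⟩
  have hheight : ∀ {t l}, IsParentSeq [t] l → (extendDepths [0] l).foldr max 0 = t.height := by
    intro t l h
    simpa using h.foldr_max [0] rfl
  have hsize : ∀ {t l}, IsParentSeq [t] l → l.length + 1 = t.size := by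
    intro t l h
    simpa using h.length_add
  choose t ht using hex
  refine Nat.card_eq_of_bijective (fun f => ⟨t f, by simp [← hsize (ht f)],
    (hheight (ht f)).symm.trans f.2.2.2⟩) ⟨fun f g hfg => ?_, fun ⟨u, hu, hu'⟩ => ?_⟩
  · have htt : t f = t g := congrArg Subtype.val hfg
    have := ht g
    rw [← htt] at this
    exact Subtype.ext (List.ofFn_injective ((ht f).seq_unique this))
  · obtain ⟨l, hl⟩ := IsParentSeq.exists_seq [u]
    obtain rfl : l.length = n := by
      have := hsize hl
      omega
    have hofFn : List.ofFn l.get = l := List.ofFn_get l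
    let f : CodeSeq l.length H := ⟨l.get, List.sortedLE_ofFn_iff.1 (by
        rw [hofFn]; exact hl.pairwise.sortedLE), fun i => by
        have := (entriesLt_iff _ _).1 hl.entriesLt i i.2
        simp only [List.length_singleton] at this
        simp only [List.get_eq_getElem]
        omega, by rw [hofFn, hheight hl, hu']⟩
    have hf := ht f
    rw [show List.ofFn f.1 = l from hofFn] at hf
    refine ⟨f, Subtype.ext ?_⟩
    simpa using hf.forest_unique hl rfl

theorem statement4 (n H : ℕ) (hn : 1 ≤ n) :
    fEx H n = Nat.card {tr : PTree // tr.size = n + 1 ∧ tr.height = H + 1} := by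
  rw [← card_codeSeq_eq_fEx, card_codeSeq_eq_card_trees]

end Paper
end

section
/- For every n ≥ 1 and H ≥ 0, the number of nonisomorphic n-element semiorders of length H equals the number of Dyck paths of semilength n and height H+1. -/
namespace Paper

/-- The set `S` is finite and has `z` elements. -/
def HasCount {α : Type*} (S : Set α) (z : ℤ) : Prop := ∃ c : ℕ, S.encard = c ∧ (c : ℤ) = z

theorem HasCount.finite {α : Type*} {S : Set α} {z : ℤ} (h : HasCount S z) : S.Finite := by
  obtain ⟨c, hc, -⟩ := h
  exact Set.finite_of_encard_eq_coe hc

theorem HasCount.ncard_eq {α : Type*} {S : Set α} {z : ℤ} (h : HasCount S z) :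
    (S.ncard : ℤ) = z := by
  obtain ⟨c, hc, rfl⟩ := h
  simp [Set.ncard_def, hc]

theorem hasCount_empty {α : Type*} : HasCount (∅ : Set α) 0 := ⟨0, by simp, rfl⟩

theorem hasCount_singleton {α : Type*} (a : α) : HasCount ({a} : Set α) 1 := ⟨1, by simp, rfl⟩

theorem HasCount.union {α : Type*} {S T : Set α} {y z : ℤ} (hS : HasCount S y)
    (hT : HasCount T z) (h : Disjoint S T) : HasCount (S ∪ T) (y + z) := by
  obtain ⟨a, ha, rfl⟩ := hS
  obtain ⟨b, hb, rfl⟩ := hT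
  exact ⟨a + b, by rw [Set.encard_union_eq h, ha, hb]; simp, by simp⟩

theorem HasCount.image {α β : Type*} {S : Set α} {z : ℤ} (hS : HasCount S z) {f : α → β}
    (hf : Function.Injective f) : HasCount (f '' S) z := by
  obtain ⟨a, ha, rfl⟩ := hS
  exact ⟨a, by rw [hf.encard_image, ha], rfl⟩

open PowerSeries in
/-- The generating function, by semilength, of the Dyck paths of height at most `k`. -/
noncomputable def dyckSeries : ℕ → PowerSeries ℤ
  | 0 => 1
  | k + 1 => invOfUnit (1 - X * dyckSeries k) 1

open PowerSeries in
theorem dyckSeries_succ (k : ℕ) :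
    dyckSeries (k + 1) = 1 + X * (dyckSeries k * dyckSeries (k + 1)) := by
  have h : (1 - X * dyckSeries k) * dyckSeries (k + 1) = 1 := by
    rw [dyckSeries]
    exact mul_invOfUnit _ _ (by simp)
  linear_combination h

/-- The list `l` is a path from height `h` to height `0` staying between heights `0` and `K`. -/
def IsBoundedPath (K : ℕ) : ℕ → List Bool → Prop
  | h, [] => h = 0
  | h, true :: l => h + 1 ≤ K ∧ IsBoundedPath K (h + 1) l
  | h, false :: l => 1 ≤ h ∧ IsBoundedPath K (h - 1) l

open PowerSeries in
/-- The generating function, by number of up-steps, of the paths from height `h` to height `0`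
staying between heights `0` and `K`. -/
noncomputable def boundedPathSeries (K h : ℕ) : PowerSeries ℤ :=
  ∏ j ∈ Finset.range (h + 1), dyckSeries (K - j)

open PowerSeries in
theorem boundedPathSeries_zero (K : ℕ) :
    boundedPathSeries K 0 = 1 + if 1 ≤ K then X * boundedPathSeries K 1 else 0 := by
  cases K with
  | zero => simp [boundedPathSeries, dyckSeries]
  | succ K =>
    simp only [boundedPathSeries, Finset.prod_range_succ, Finset.prod_range_zero]
    simp only [Nat.sub_zero, Nat.add_sub_cancel, one_mul, le_add_iff_nonneg_left, zero_le, if_true]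
    linear_combination dyckSeries_succ K

open PowerSeries in
theorem boundedPathSeries_succ {K h : ℕ} (hK : h + 1 ≤ K) :
    boundedPathSeries K (h + 1) =
      boundedPathSeries K h + if h + 2 ≤ K then X * boundedPathSeries K (h + 2) else 0 := by
  obtain ⟨d, rfl⟩ := Nat.exists_eq_add_of_le hK
  simp only [boundedPathSeries]
  rw [Finset.prod_range_succ _ (h + 2), Finset.prod_range_succ _ (h + 1)]
  have e1 : h + 1 + d - (h + 1) = d := by omega
  have e2 : h + 1 + d - (h + 2) = d - 1 := by omega
  rw [e1, e2]
  cases d with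
  | zero => simp [dyckSeries]
  | succ d =>
    rw [if_pos (by omega), Nat.add_sub_cancel]
    linear_combination (∏ j ∈ Finset.range (h + 1), dyckSeries (h + 1 + (d + 1) - j)) *
      dyckSeries_succ d

open PowerSeries in
theorem hasCount_boundedPath (K L h n : ℕ) (hK : h ≤ K) (hL : L = h + 2 * n) :
    HasCount {l : List Bool | l.length = L ∧ IsBoundedPath K h l}
      (coeff n (boundedPathSeries K h)) := by
  induction L generalizing h n with
  | zero =>
    obtain rfl : h = 0 := by omega
    obtain rfl : n = 0 := by omega
    convert hasCount_singleton ([] : List Bool) using 1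
    · ext l
      simp only [Set.mem_ofPred_eq, List.length_eq_zero_iff, Set.mem_singleton_iff]
      exact ⟨fun h => h.1, fun h => ⟨h, by subst h; rfl⟩⟩
    · rw [boundedPathSeries_zero]
      split_ifs <;> simp
  | succ L ih =>
    have hsplit : {l : List Bool | l.length = L + 1 ∧ IsBoundedPath K h l} =
        (List.cons true '' {l | h + 1 ≤ K ∧ l.length = L ∧ IsBoundedPath K (h + 1) l}) ∪
        (List.cons false '' {l | 1 ≤ h ∧ l.length = L ∧ IsBoundedPath K (h - 1) l}) := by
      ext l
      rcases l with _ | ⟨_ | _, l⟩ <;> simp [IsBoundedPath] <;> tauto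
    have hdisj : Disjoint
        (List.cons true '' {l | h + 1 ≤ K ∧ l.length = L ∧ IsBoundedPath K (h + 1) l})
        (List.cons false '' {l | 1 ≤ h ∧ l.length = L ∧ IsBoundedPath K (h - 1) l}) := by
      rw [Set.disjoint_left]
      rintro _ ⟨a, -, rfl⟩ ⟨b, -, hb⟩
      simp at hb
    have hup : HasCount {l | h + 1 ≤ K ∧ l.length = L ∧ IsBoundedPath K (h + 1) l}
        (coeff n (if h + 1 ≤ K then X * boundedPathSeries K (h + 1) else 0)) := by
      by_cases hh : h + 1 ≤ K
      · rcases n with _ | n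
        · convert hasCount_empty
          · ext l
            simp only [Set.mem_ofPred_eq, Set.mem_empty_iff_false, iff_false]
            rintro ⟨-, hl, hp⟩
            have key : ∀ (l : List Bool) (h : ℕ), IsBoundedPath K h l → h ≤ l.length := by
              intro l
              induction l with
              | nil => intro h hp; simp [IsBoundedPath] at hp; simp [hp]
              | cons b l ih =>
                intro h hp
                cases b
                · have := ih _ hp.2; simp; omega
                · have := ih _ hp.2; simp; omega
            have := key _ _ hp
            omega
          · simp [hh]
        · simp only [hh, true_and, if_true, coeff_succ_X_mul]
          exact ih (h + 1) n hh (by omega)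
      · simp only [hh, false_and, if_false, map_zero]
        exact hasCount_empty
    rw [hsplit]
    rcases h with _ | h
    · have hdown : HasCount {l | 1 ≤ 0 ∧ l.length = L ∧ IsBoundedPath K (0 - 1) l} 0 := by
        convert hasCount_empty
        simp
      convert (hup.image (List.cons_injective (a := true))).union
        (hdown.image (List.cons_injective (a := false))) hdisj using 1
      rw [boundedPathSeries_zero, map_add, coeff_one, if_neg (by omega)]
      ring
    · have hdown : HasCount {l | 1 ≤ h + 1 ∧ l.length = L ∧ IsBoundedPath K (h + 1 - 1) l}
          (coeff n (boundedPathSeries K h)) := by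
        simpa using ih h n (by omega) (by omega)
      convert (hup.image (List.cons_injective (a := true))).union
        (hdown.image (List.cons_injective (a := false))) hdisj using 1
      rw [boundedPathSeries_succ hK, map_add, add_comm]

theorem hasCount_dyck (K n : ℕ) :
    HasCount {l : List Bool | l.length = 2 * n ∧ IsBoundedPath K 0 l}
      (PowerSeries.coeff n (dyckSeries K)) := by
  simpa [boundedPathSeries] using hasCount_boundedPath K (2 * n) 0 n (by omega) (by omega)

theorem isBoundedPath_iff (K : ℕ) (l : List Bool) (h : ℕ) (hK : h ≤ K) :
    IsBoundedPath K h l ↔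
      h + pathVal l = 0 ∧ ∀ p, p <+: l → 0 ≤ h + pathVal p ∧ h + pathVal p ≤ K := by
  induction l generalizing h with
  | nil => simp [IsBoundedPath, pathVal]; omega
  | cons b l ih =>
    have hc : ∀ b l, pathVal (b :: l) = (if b then 1 else -1) + pathVal l := by
      intro b l; simp [pathVal]
    have hn : pathVal [] = 0 := rfl
    have hpre : (∀ p, p <+: b :: l → 0 ≤ h + pathVal p ∧ h + pathVal p ≤ K) ↔
        ∀ p, p <+: l → 0 ≤ h + pathVal (b :: p) ∧ h + pathVal (b :: p) ≤ K := by
      constructor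
      · intro H p hp
        exact H _ (by simpa using hp)
      · intro H p hp
        rcases List.prefix_cons_iff.1 hp with rfl | ⟨t, rfl, ht⟩
        · rw [hn]; omega
        · exact H t ht
    rw [hpre]
    simp only [hc]
    cases b
    · simp only [IsBoundedPath, Bool.false_eq_true, if_false]
      constructor
      · rintro ⟨h1, h2⟩
        rw [ih _ (by omega)] at h2
        push_cast [h1] at h2
        simpa [add_assoc, sub_eq_add_neg] using h2
      · intro H
        have h1 : 1 ≤ h := by
          have := H.2 [] List.nil_prefix
          rw [hn] at this; omega
        refine ⟨h1, ?_⟩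
        rw [ih _ (by omega)]
        push_cast [h1]
        simpa [add_assoc, sub_eq_add_neg] using H
    · simp only [IsBoundedPath, if_true]
      constructor
      · rintro ⟨h1, h2⟩
        rw [ih _ (by omega)] at h2
        push_cast at h2
        simpa [add_assoc] using h2
      · intro H
        have h1 : h + 1 ≤ K := by
          have := H.2 [] List.nil_prefix
          rw [hn] at this; omega
        refine ⟨h1, ?_⟩
        rw [ih _ (by omega)]
        push_cast
        simpa [add_assoc] using H

theorem IsBoundedPath.mono {K K' : ℕ} (hK : K ≤ K') {h : ℕ} {l : List Bool}
    (hl : IsBoundedPath K h l) : IsBoundedPath K' h l := by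
  induction l generalizing h with
  | nil => exact hl
  | cons b l ih =>
    cases b
    · exact ⟨hl.1, ih hl.2⟩
    · exact ⟨hl.1.trans hK, ih hl.2⟩

theorem isDyckPath_and_heightIs_iff (l : List Bool) (H : ℕ) :
    IsDyckPath l ∧ DyckHeightIs l (H + 1) ↔
      IsBoundedPath (H + 1) 0 l ∧ ¬ IsBoundedPath H 0 l := by
  rw [isBoundedPath_iff _ _ _ (Nat.zero_le _), isBoundedPath_iff _ _ _ (Nat.zero_le _)]
  simp only [IsDyckPath, DyckHeightIs, Nat.cast_zero, zero_add]
  constructor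
  · rintro ⟨⟨h0, hpos⟩, ⟨p, hp, hpv⟩, hle⟩
    refine ⟨⟨h0, fun q hq => ⟨hpos q hq, hle q hq⟩⟩, fun h => ?_⟩
    have := (h.2 p hp).2
    push_cast at hpv
    omega
  · rintro ⟨⟨h0, hb⟩, hn⟩
    refine ⟨⟨h0, fun q hq => (hb q hq).1⟩, ?_, fun q hq => (hb q hq).2⟩
    by_contra! hne
    refine hn ⟨h0, fun q hq => ⟨(hb q hq).1, ?_⟩⟩
    have h1 := hne q hq
    have h2 := (hb q hq).2
    push_cast at h1 h2
    omega

theorem natCard_dyck_height (n H : ℕ) :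
    (Nat.card {l : List Bool // l.length = 2 * n ∧ IsDyckPath l ∧ DyckHeightIs l (H + 1)} : ℤ) =
      PowerSeries.coeff n (dyckSeries (H + 1)) - PowerSeries.coeff n (dyckSeries H) := by
  have hset : {l : List Bool | l.length = 2 * n ∧ IsDyckPath l ∧ DyckHeightIs l (H + 1)} =
      {l | l.length = 2 * n ∧ IsBoundedPath (H + 1) 0 l} \
        {l | l.length = 2 * n ∧ IsBoundedPath H 0 l} := by
    ext l
    simp only [isDyckPath_and_heightIs_iff, Set.mem_ofPred_eq, Set.mem_sdiff]
    tauto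
  have hsub : {l : List Bool | l.length = 2 * n ∧ IsBoundedPath H 0 l} ⊆
      {l | l.length = 2 * n ∧ IsBoundedPath (H + 1) 0 l} :=
    fun l hl => ⟨hl.1, hl.2.mono (Nat.le_succ H)⟩
  have hcard := Set.ncard_sdiff_add_ncard_of_subset hsub (hasCount_dyck (H + 1) n).finite
  rw [← (hasCount_dyck (H + 1) n).ncard_eq, ← (hasCount_dyck H n).ncard_eq, ← hcard, ← hset]
  push_cast
  rw [add_sub_cancel_right]
  rfl

/-- Admissible continuations of a greedy level decomposition. The list `t` holds the numbers of
predecessors of the elements `i, i + 1, …`; the current level starts at element `s`, values are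
nondecreasing and at least `c`, and at most `k` further levels may be opened. -/
def IsTail : ℕ → ℕ → ℕ → ℕ → List ℕ → Prop
  | _, _, _, _, [] => True
  | k, s, c, i, x :: t =>
    c ≤ x ∧ x ≤ i ∧ ((x ≤ s ∧ IsTail k s x (i + 1) t) ∨
      (s < x ∧ 0 < k ∧ IsTail (k - 1) i x (i + 1) t))

open PowerSeries in
theorem hasCount_isTail (m k s c i : ℕ) (hs : s ≤ i) (hc : c ≤ s + 1) :
    HasCount {t : List ℕ | t.length = m ∧ IsTail k s c i t}
      (coeff m (dyckSeries (k + 1) ^ (s + 1 - c) * dyckSeries k ^ (i - s))) := by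
  match m with
  | 0 =>
    convert hasCount_singleton ([] : List ℕ) using 1
    · ext l
      simp only [Set.mem_ofPred_eq, List.length_eq_zero_iff, Set.mem_singleton_iff]
      exact ⟨fun h => h.1, fun h => ⟨h, by subst h; trivial⟩⟩
    · have h : ∀ k, constantCoeff (dyckSeries k) = 1 := by
        intro k
        cases k with
        | zero => simp [dyckSeries]
        | succ k => rw [dyckSeries_succ]; simp
      simp [h]
  | m + 1 =>
    by_cases hsc : s < c
    · have hcs : c = s + 1 := by omega
      match k with
      | 0 =>
        convert hasCount_empty
        · ext t
          rcases t with _ | ⟨x, t⟩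
          · simp
          · simp only [IsTail, Set.mem_ofPred_eq, Set.mem_empty_iff_false, iff_false]
            omega
        · simp [hcs, dyckSeries, coeff_one]
      | k + 1 =>
        convert hasCount_isTail (m + 1) k i (s + 1) i le_rfl (by omega) using 1
        · ext t
          rcases t with _ | ⟨x, t⟩
          · simp [hcs]
          · simp only [IsTail, Set.mem_ofPred_eq, Nat.add_sub_cancel, hcs]
            constructor
            · rintro ⟨h1, h2, h3, h4 | h4⟩
              · omega
              · exact ⟨h1, h2, h3, Or.inl ⟨h3, h4.2.2⟩⟩
            · rintro ⟨h1, h2, h3, h4 | h4⟩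
              · exact ⟨h1, h2, h3, Or.inr ⟨h2, by omega, h4.2⟩⟩
              · omega
        · simp [hcs]
    · rw [not_lt] at hsc
      have hplace := hasCount_isTail m k s c (i + 1) (by omega) hc
      have hadvance := hasCount_isTail (m + 1) k s (c + 1) i hs (by omega)
      convert (hplace.image (List.cons_injective (a := c))).union hadvance ?_ using 1
      · ext t
        rcases t with _ | ⟨x, t⟩
        · simp
        · simp only [IsTail, Set.mem_ofPred_eq, Set.mem_union, Set.mem_image, List.cons.injEq,
            List.length_cons, Nat.add_right_cancel_iff]
          constructor
          · rintro ⟨h1, h2, h3, h4⟩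
            rcases h2.eq_or_lt with rfl | h2
            · left
              refine ⟨t, ⟨h1, ?_⟩, rfl, rfl⟩
              rcases h4 with h4 | h4
              · exact h4.2
              · omega
            · exact Or.inr ⟨h1, h2, h3, h4⟩
          · rintro (⟨t, ⟨h1, h2⟩, rfl, rfl⟩ | ⟨h1, h2, h3, h4⟩)
            · exact ⟨h1, le_rfl, by omega, Or.inl ⟨hsc, h2⟩⟩
            · exact ⟨h1, by omega, h3, h4⟩
      · have e1 : s + 1 - c = (s - c) + 1 := by omega
        have e2 : s + 1 - (c + 1) = s - c := by omega
        have e3 : i + 1 - s = (i - s) + 1 := by omega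
        rw [e1, e2, e3, ← coeff_succ_X_mul m, ← map_add]
        congr 1
        linear_combination dyckSeries (k + 1) ^ (s - c) * dyckSeries k ^ (i - s) * dyckSeries_succ k
      · rw [Set.disjoint_left]
        rintro _ ⟨t, -, rfl⟩ ⟨-, h, -⟩
        omega
termination_by (m, k, s + 1 - c)

theorem hasCount_isTail_zero (n k : ℕ) :
    HasCount {t : List ℕ | t.length = n ∧ IsTail k 0 0 0 t}
      (PowerSeries.coeff n (dyckSeries (k + 1))) := by
  simpa using hasCount_isTail n k 0 0 0 le_rfl (by omega)

/-- The function `F` is nondecreasing and satisfies `F a ≤ a` below `n`. -/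
def IsProfile (n : ℕ) (F : ℕ → ℕ) : Prop :=
  (∀ a b, a ≤ b → b < n → F a ≤ F b) ∧ ∀ a < n, F a ≤ a

/-- The number of elements in the longest chain ending strictly below `i`, where `a` lies below `b`
when `a < F b`. -/
def rank (F : ℕ → ℕ) (i : ℕ) : ℕ :=
  if _h : 0 < F i ∧ F i ≤ i then rank F (F i - 1) + 1 else 0
termination_by i
decreasing_by omega

theorem rank_of_eq_zero {F : ℕ → ℕ} {i : ℕ} (h : F i = 0) : rank F i = 0 := by
  rw [rank]; simp [h]

theorem rank_of_pos {F : ℕ → ℕ} {i : ℕ} (h : 0 < F i) (hi : F i ≤ i) :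
    rank F i = rank F (F i - 1) + 1 := by
  rw [rank]; simp [h, hi]

theorem IsProfile.rank_mono {n : ℕ} {F : ℕ → ℕ} (hF : IsProfile n F) {a b : ℕ} (hab : a ≤ b)
    (hb : b < n) : rank F a ≤ rank F b := by
  induction b using Nat.strong_induction_on generalizing a with
  | _ b ih =>
    rcases Nat.eq_zero_or_pos (F a) with h | h
    · rw [rank_of_eq_zero h]; omega
    · have h1 := hF.1 a b hab hb
      have h2 := hF.2 a (by omega)
      have h3 := hF.2 b hb
      rw [rank_of_pos h h2, rank_of_pos (by omega) h3]
      have := ih (F b - 1) (by omega) (a := F a - 1) (by omega) (by omega)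
      omega

theorem IsProfile.rank_lt {n : ℕ} {F : ℕ → ℕ} (hF : IsProfile n F) {a b : ℕ} (hab : a < F b)
    (hb : b < n) : rank F a < rank F b := by
  have h3 := hF.2 b hb
  rw [rank_of_pos (by omega) h3]
  have := hF.rank_mono (a := a) (b := F b - 1) (by omega) (by omega)
  omega

theorem IsProfile.of_isTail {F : ℕ → ℕ} (m k s c i : ℕ) (hF : IsProfile i F)
    (hc : ∀ j < i, F j ≤ c) (h : IsTail k s c i ((List.range' i m).map F)) :
    IsProfile (i + m) F := by
  induction m generalizing k s c i with
  | zero => exact hF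
  | succ m ih =>
    rw [List.range'_succ, List.map_cons, IsTail] at h
    obtain ⟨h1, h2, h3⟩ := h
    have hF' : IsProfile (i + 1) F := by
      refine ⟨fun a b hab hb => ?_, fun a ha => ?_⟩
      · rcases Nat.lt_succ_iff_lt_or_eq.1 hb with hb | rfl
        · exact hF.1 a b hab hb
        · rcases hab.eq_or_lt with rfl | hab
          · exact le_rfl
          · exact (hc a hab).trans h1
      · rcases Nat.lt_succ_iff_lt_or_eq.1 ha with ha | rfl
        · exact hF.2 a ha
        · exact h2
    have hc' : ∀ j < i + 1, F j ≤ F i := fun j hj => hF'.1 j i (by omega) (by omega)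
    rw [show i + (m + 1) = i + 1 + m by omega]
    rcases h3 with h3 | h3
    · exact ih _ _ _ _ hF' hc' h3.2
    · exact ih _ _ _ _ hF' hc' h3.2.2

theorem isTail_iff_rank_le {F : ℕ → ℕ} (m k s c i r : ℕ) (hF : IsProfile (i + m) F)
    (hc : 0 < m → c ≤ F i) (hsi : s ≤ i) (hlt : ∀ j < s, rank F j < r)
    (heq : ∀ j, s ≤ j → j < i → rank F j = r) (hr : r = 0 ∨ s < i) :
    IsTail k s c i ((List.range' i m).map F) ↔ ∀ j < i + m, rank F j ≤ r + k := by
  induction m generalizing k s c i r with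
  | zero =>
    simp only [List.range'_zero, List.map_nil, IsTail, true_iff]
    intro j hj
    rcases Nat.lt_or_ge j s with h | h
    · have := hlt j h; omega
    · have := heq j h hj; omega
  | succ m ih =>
    rw [List.range'_succ, List.map_cons, IsTail]
    have hi := hF.2 i (by omega)
    have hci := hc (by omega)
    rw [show i + (m + 1) = i + 1 + m by omega] at hF ⊢
    have hnext : 0 < m → F i ≤ F (i + 1) := fun hm => hF.1 _ _ (by omega) (by omega)
    rcases Nat.lt_or_ge s (F i) with hs | hs
    · have hri : rank F i = r + 1 := by
        rw [rank_of_pos (by omega) hi, heq (F i - 1) (by omega) (by omega)]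
      have hlt' : ∀ j < i, rank F j < r + 1 := by
        intro j hj
        rcases Nat.lt_or_ge j s with h | h
        · have := hlt j h; omega
        · have := heq j h hj; omega
      have heq' : ∀ j, i ≤ j → j < i + 1 → rank F j = r + 1 := by
        intro j h1 h2
        obtain rfl : j = i := by omega
        exact hri
      rcases k with _ | k
      · have := fun h : ∀ j < i + 1 + m, rank F j ≤ r + 0 => h i (by omega)
        constructor
        · rintro ⟨_, _, h | h⟩ <;> omega
        · intro h
          have := this h
          omega
      · have := ih k i (F i) (i + 1) (r + 1) hF hnext (by omega) hlt' heq' (by omega)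
        rw [show r + (k + 1) = r + 1 + k by omega, ← this]
        constructor
        · rintro ⟨_, _, h | h⟩
          · omega
          · exact h.2.2
        · exact fun h => ⟨hci, hi, Or.inr ⟨hs, by omega, h⟩⟩
    · have hri : rank F i = r := by
        apply le_antisymm
        · rcases Nat.eq_zero_or_pos (F i) with h | h
          · rw [rank_of_eq_zero h]; omega
          · rw [rank_of_pos h hi]
            exact hlt _ (by omega)
        · rcases hr with rfl | hr
          · omega
          · rw [← heq s le_rfl hr]
            exact hF.rank_mono hsi (by omega)
      have heq' : ∀ j, s ≤ j → j < i + 1 → rank F j = r := by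
        intro j h1 h2
        rcases Nat.lt_succ_iff_lt_or_eq.1 h2 with h2 | rfl
        · exact heq j h1 h2
        · exact hri
      rw [← ih k s (F i) (i + 1) r hF hnext (by omega) hlt heq' (by omega)]
      constructor
      · rintro ⟨_, _, h | h⟩
        · exact h.2
        · omega
      · exact fun h => ⟨hci, hi, Or.inl ⟨hs, h⟩⟩

theorem isTail_zero_iff {n k : ℕ} {t : List ℕ} (ht : t.length = n) :
    IsTail k 0 0 0 t ↔
      IsProfile n (t.getD · 0) ∧ ∀ j < n, rank (t.getD · 0) j ≤ k := by
  have hmap : (List.range' 0 n).map (t.getD · 0) = t := by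
    apply List.ext_getElem
    · simp [ht]
    · intro i h1 h2
      simp [h2]
  have hvac : IsProfile 0 (t.getD · 0) := ⟨by omega, by omega⟩
  constructor
  · intro h
    rw [← hmap] at h
    have hF := IsProfile.of_isTail n k 0 0 0 hvac (by omega) h
    rw [isTail_iff_rank_le n k 0 0 0 0 hF (by omega) le_rfl (by omega) (by omega)
      (Or.inl rfl)] at h
    simp only [zero_add] at hF h
    exact ⟨hF, h⟩
  · rintro ⟨hF, h⟩
    rw [← hmap, isTail_iff_rank_le n k 0 0 0 0 (by simpa using hF) (by omega) le_rfl (by omega)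
      (by omega) (Or.inl rfl)]
    simpa using h

/-- The poset on `Fin n` in which `a` lies below `b` when `a < F b`. -/
@[reducible] def profileOrder (n : ℕ) (F : ℕ → ℕ) (hF : IsProfile n F) : PartialOrder (Fin n) where
  le a b := a = b ∨ (a : ℕ) < F b
  lt a b := (a : ℕ) < F b
  le_refl a := Or.inl rfl
  le_trans a b c := by
    rintro (rfl | hab) (rfl | hbc)
    · exact Or.inl rfl
    · exact Or.inr hbc
    · exact Or.inr hab
    · have := hF.2 b b.2
      have := hF.2 c c.2
      have := hF.1 b c (by omega) c.2
      exact Or.inr (by omega)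
  le_antisymm a b := by
    rintro (rfl | hab) (h | hba)
    · rfl
    · rfl
    · exact h.symm
    · have := hF.2 a a.2
      have := hF.2 b b.2
      omega
  lt_iff_le_not_ge a b := by
    have ha := hF.2 a a.2
    have hb := hF.2 b b.2
    constructor
    · refine fun h => ⟨Or.inr h, ?_⟩
      rintro (rfl | h') <;> omega
    · rintro ⟨rfl | h, h'⟩
      · exact absurd (Or.inl rfl) h'
      · exact h

theorem profileOrder_isSemiorder {n : ℕ} {F : ℕ → ℕ} (hF : IsProfile n F) :
    @IsSemiorder (Fin n) (profileOrder n F hF) := by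
  have hinc : ∀ {a b : Fin n}, @Incomp _ (profileOrder n F hF) a b → F b ≤ a ∧ F a ≤ b := by
    intro a b h
    exact ⟨not_lt.1 fun h' => h.1 (Or.inr h'), not_lt.1 fun h' => h.2 (Or.inr h')⟩
  constructor
  · rintro ⟨x, y, z, w, hyx, hwz, -, hxw, hyz, -⟩
    have h1 := (hinc hxw).2
    have h2 := (hinc hyz).1
    change (y : ℕ) < F x at hyx
    change (w : ℕ) < F z at hwz
    omega
  · rintro ⟨x, y, z, w, hzy, hyx, hxw, -, hzw⟩
    have h1 := (hinc hxw).2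
    have h2 := (hinc hzw).1
    change (z : ℕ) < F y at hzy
    change (y : ℕ) < F x at hyx
    have := hF.1 y w (by omega) w.2
    omega

theorem profileOrder_hasChain_iff {n : ℕ} {F : ℕ → ℕ} (hF : IsProfile n F) (k : ℕ) :
    @HasChain (Fin n) (profileOrder n F hF).toPreorder (k + 1) ↔ ∃ j < n, k ≤ rank F j := by
  constructor
  · rintro ⟨c, hc⟩
    have key : ∀ j : ℕ, ∀ h : j < k + 1, j ≤ rank F (c ⟨j, h⟩) := by
      intro j
      induction j with
      | zero => intro h; omega
      | succ j ih =>
        intro h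
        have h1 := ih (by omega)
        have h2 : (c ⟨j, by omega⟩ : ℕ) < F (c ⟨j + 1, h⟩) := hc (Nat.lt_succ_self j)
        have := hF.rank_lt h2 (c ⟨j + 1, h⟩).2
        omega
    exact ⟨_, (c ⟨k, by omega⟩).2, key k (by omega)⟩
  · rintro ⟨j, hj, hk⟩
    have key : ∀ k j : ℕ, ∀ hj : j < n, k ≤ rank F j →
        ∃ c : Fin (k + 1) → Fin n,
          @StrictMono _ _ _ (profileOrder n F hF).toPreorder c ∧ c (Fin.last k) = ⟨j, hj⟩ := by
      intro k
      induction k with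
      | zero =>
        refine fun j hj _ => ⟨fun _ => ⟨j, hj⟩, fun a b hab => ?_, rfl⟩
        exact absurd hab (by simp [Subsingleton.elim (α := Fin 1) a b])
      | succ k ih =>
        intro j hj hk
        have hle := hF.2 j hj
        have hpos : 0 < F j := by
          by_contra h
          rw [rank_of_eq_zero (by omega)] at hk
          omega
        rw [rank_of_pos hpos hle] at hk
        obtain ⟨c, hc, hlast⟩ := ih (F j - 1) (by omega) (by omega)
        refine ⟨Fin.snoc c ⟨j, hj⟩, ?_, by simp⟩
        refine (@Fin.strictMono_iff_lt_succ _ _ (profileOrder n F hF).toPreorder _).2 fun i => ?_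
        refine Fin.lastCases ?_ (fun i => ?_) i
        · rw [Fin.succ_last, Fin.snoc_last, Fin.snoc_castSucc, hlast]
          change F j - 1 < F j
          omega
        · rw [Fin.succ_castSucc, Fin.snoc_castSucc, Fin.snoc_castSucc]
          exact hc Fin.castSucc_lt_succ
    obtain ⟨c, hc, -⟩ := key k j hj hk
    exact ⟨c, hc⟩

theorem card_lt_profileOrder {n : ℕ} {F : ℕ → ℕ} (hF : IsProfile n F) (b : Fin n) :
    Nat.card {a : Fin n // (profileOrder n F hF).lt a b} = F b := by
  have hb := hF.2 b b.2
  have e : {a : Fin n // (profileOrder n F hF).lt a b} ≃ Fin (F b) :=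
    { toFun := fun a => ⟨a.1, a.2⟩
      invFun := fun j => ⟨⟨j, by omega⟩, j.2⟩
      left_inv := fun a => rfl
      right_inv := fun j => rfl }
  rw [Nat.card_congr e, Nat.card_fin]

/-- A nondecreasing profile is determined by the isomorphism type of its poset. -/
theorem profile_eq_of_iso {n : ℕ} {F G : ℕ → ℕ} (hF : IsProfile n F) (hG : IsProfile n G)
    (e : Fin n ≃ Fin n)
    (he : ∀ a b, (profileOrder n F hF).le a b ↔ (profileOrder n G hG).le (e a) (e b))
    {j : ℕ} (hj : j < n) : F j = G j := by
  have hlt : ∀ a b, (profileOrder n F hF).lt a b ↔ (profileOrder n G hG).lt (e a) (e b) := by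
    intro a b
    rw [(profileOrder n F hF).lt_iff_le_not_ge, (profileOrder n G hG).lt_iff_le_not_ge]
    exact and_congr (he a b) (not_congr (he b a))
  have hFG : ∀ b : Fin n, G (e b) = F b := by
    intro b
    rw [← card_lt_profileOrder hF b, ← card_lt_profileOrder hG (e b)]
    exact Nat.card_congr (e.subtypeEquiv fun a => hlt a b).symm
  have hmF : Monotone ((fun b : Fin n => G b) ∘ e) := by
    intro a b hab
    simp only [Function.comp_apply, hFG]
    exact hF.1 a b hab b.2
  have hmG : Monotone ((fun b : Fin n => G b) ∘ (1 : Equiv.Perm (Fin n))) :=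
    fun a b hab => hG.1 a b hab b.2
  have := congrFun (Tuple.unique_monotone (σ := e) hmF hmG) ⟨j, hj⟩
  simp only [Function.comp_apply, hFG, Equiv.Perm.coe_one, id] at this
  exact this

theorem IsSemiorder.lt_of_card_le {α : Type*} [PartialOrder α] [Finite α] (hα : IsSemiorder α)
    {a b c : α} (hbc : b < c) (hd : (Set.Iio a).ncard ≤ (Set.Iio b).ncard)
    (hu : (Set.Iio a).ncard = (Set.Iio b).ncard → (Set.Ioi b).ncard ≤ (Set.Ioi a).ncard) :
    a < c := by
  by_contra hac
  rcases hd.eq_or_lt with hd | hd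
  · have hsub : ¬ Set.Ioi a ⊆ Set.Ioi b := by
      intro h
      have := Set.eq_of_subset_of_ncard_le h (hu hd) (Set.toFinite _)
      exact hac (this.symm ▸ hbc : c ∈ Set.Ioi a)
    obtain ⟨w, haw, hbw⟩ := Set.not_subset.1 hsub
    simp only [Set.mem_Ioi] at haw hbw
    -- `b < c` and `a < w` would form an induced `2+2`, unless `a`, `b` have different lower sets
    have key : a = c ∨ w = b ∨ c ≤ a ∨ w ≤ b ∨ c ≤ w ∨ a ≤ b ∨ w ≤ c ∨ b ≤ a := by
      by_contra! hk
      obtain ⟨-, -, h3, h4, h5, h6, h7, h8⟩ := hk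
      refine hα.1 ⟨c, b, w, a, hbc, haw, ⟨h5, h7⟩, ⟨h3, fun h => ?_⟩, ⟨fun h => ?_, h4⟩, ⟨h8, h6⟩⟩
      · rcases h.eq_or_lt with rfl | h
        · exact h3 le_rfl
        · exact hac h
      · rcases h.eq_or_lt with rfl | h
        · exact h4 le_rfl
        · exact hbw h
    have hcard : ∀ {x y : α}, x < y → (Set.Iio x).ncard < (Set.Iio y).ncard := by
      intro x y hxy
      apply Set.ncard_lt_ncard _ (Set.toFinite _)
      exact Set.ssubset_iff_of_subset (fun z hz => lt_trans hz hxy) |>.2 ⟨x, hxy, lt_irrefl x⟩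
    have hnab : ¬ a < b := fun h => (hcard h).ne hd
    have hnba : ¬ b < a := fun h => (hcard h).ne' hd
    have hne : a ≠ b := fun h => hac (h ▸ hbc)
    rcases key with rfl | rfl | h | h | h | h | h | h
    · exact hnba hbc
    · exact hnab haw
    · exact hnba (hbc.trans_le h)
    · exact hnab (haw.trans_le h)
    · exact hbw (hbc.trans_le h)
    · exact hnab (lt_of_le_of_ne h hne)
    · exact hac (haw.trans_le h)
    · exact hnba (lt_of_le_of_ne h hne.symm)
  · have hsub : ¬ Set.Iio b ⊆ Set.Iio a := fun h =>
      absurd (Set.ncard_le_ncard h (Set.toFinite _)) (by omega)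
    obtain ⟨z, hzb, hza⟩ := Set.not_subset.1 hsub
    simp only [Set.mem_Iio] at hzb hza
    have hab : ¬ a ≤ b := fun h => hac (h.trans_lt hbc)
    have haz : ¬ a ≤ z := fun h => hab (h.trans hzb.le)
    have hba : ¬ b ≤ a := fun h => hza (hzb.trans_le h)
    have hca : ¬ c ≤ a := fun h => hba (hbc.le.trans h)
    have hac' : ¬ a ≤ c := by
      intro h
      rcases h.eq_or_lt with rfl | h
      · exact hca le_rfl
      · exact hac h
    have hza' : ¬ z ≤ a := by
      intro h
      rcases h.eq_or_lt with rfl | h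
      · exact haz le_rfl
      · exact hza h
    exact hα.2 ⟨c, b, z, a, hzb, hbc, ⟨hca, hac'⟩, ⟨hba, hab⟩, ⟨hza', haz⟩⟩

/-- Every finite semiorder is isomorphic to the poset of a profile. -/
theorem IsSemiorder.exists_profile {α : Type*} [PartialOrder α] (hα : IsSemiorder α) {n : ℕ}
    (e : Fin n ≃ α) :
    ∃ (F : ℕ → ℕ) (hF : IsProfile n F) (σ : Fin n ≃ α),
      ∀ a b, (profileOrder n F hF).le a b ↔ σ a ≤ σ b := by
  have : Finite α := Finite.of_equiv _ e
  let d : α → ℕ := fun a => (Set.Iio a).ncard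
  let u : α → ℕ := fun a => (Set.Ioi a).ncard
  let key : α → ℕ ×ₗ ℕᵒᵈ := fun a => toLex (d a, OrderDual.toDual (u a))
  let σ : Fin n ≃ α := (Tuple.sort (key ∘ e)).trans e
  have hσ : Monotone (key ∘ σ) := Tuple.monotone_sort (key ∘ e)
  have hkey : ∀ i j : Fin n, i ≤ j →
      d (σ i) ≤ d (σ j) ∧ (d (σ i) = d (σ j) → u (σ j) ≤ u (σ i)) := by
    intro i j hij
    have h := hσ hij
    simp only [Function.comp_apply, key, Prod.Lex.toLex_le_toLex, OrderDual.toDual_le_toDual] at h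
    rcases h with h | h
    · exact ⟨h.le, fun h' => absurd h' h.ne⟩
    · exact ⟨h.1.le, fun _ => h.2⟩
  have hdown : ∀ i j k : Fin n, i ≤ j → σ j < σ k → σ i < σ k := by
    intro i j k hij hjk
    exact hα.lt_of_card_le hjk (hkey i j hij).1 (hkey i j hij).2
  have hinit : ∀ i k : Fin n, σ i < σ k ↔ (i : ℕ) < d (σ k) := by
    intro i k
    have hset : d (σ k) = {j : Fin n | σ j < σ k}.ncard := by
      have : Set.Iio (σ k) = σ '' {j : Fin n | σ j < σ k} := by
        ext x
        constructor
        · intro hx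
          exact ⟨σ.symm x, by simpa using hx, by simp⟩
        · rintro ⟨j, hj, rfl⟩
          exact hj
      simp only [d]
      rw [this, Set.ncard_image_of_injective _ σ.injective]
    rw [hset]
    constructor
    · intro h
      have hsub : (Set.Iic i : Set (Fin n)) ⊆ {j : Fin n | σ j < σ k} :=
        fun j hj => hdown j i k hj h
      have := Set.ncard_le_ncard hsub (Set.toFinite _)
      rw [← Finset.coe_Iic, Set.ncard_coe_finset, Fin.card_Iic] at this
      omega
    · intro h
      by_contra hn
      have hsub : {j : Fin n | σ j < σ k} ⊆ (Set.Iio i : Set (Fin n)) := by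
        intro j hj
        by_contra hji
        exact hn (hdown i j k (not_lt.1 hji) hj)
      have := Set.ncard_le_ncard hsub (Set.toFinite _)
      rw [← Finset.coe_Iio, Set.ncard_coe_finset, Fin.card_Iio] at this
      omega
  let F : ℕ → ℕ := fun j => if h : j < n then d (σ ⟨j, h⟩) else 0
  have hFd : ∀ k : Fin n, F k = d (σ k) := fun k => by simp [F]
  have hF : IsProfile n F := by
    refine ⟨fun a b hab hb => ?_, fun a ha => ?_⟩
    · rw [hFd ⟨a, by omega⟩, hFd ⟨b, hb⟩]
      exact (hkey ⟨a, by omega⟩ ⟨b, hb⟩ hab).1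
    · by_contra h
      have h' : σ ⟨a, ha⟩ < σ ⟨a, ha⟩ := (hinit _ _).2 (by rw [← hFd]; simpa using h)
      exact lt_irrefl _ h'
  refine ⟨F, hF, σ, fun a b => ?_⟩
  change (a = b ∨ (a : ℕ) < F b) ↔ _
  rw [hFd, ← hinit]
  rw [le_iff_eq_or_lt, σ.injective.eq_iff]

theorem hasChain_of_iso {n k : ℕ} {P Q : PartialOrder (Fin n)} (e : Fin n ≃ Fin n)
    (he : ∀ a b, P.le a b ↔ Q.le (e a) (e b)) (h : @HasChain _ P.toPreorder k) :
    @HasChain _ Q.toPreorder k := by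
  obtain ⟨c, hc⟩ := h
  refine ⟨e ∘ c, fun i j hij => ?_⟩
  have h1 := (P.lt_iff_le_not_ge _ _).1 (hc hij)
  exact (Q.lt_iff_le_not_ge _ _).2 ⟨(he _ _).1 h1.1, fun h => h1.2 ((he _ _).2 h)⟩

/-- The profiles of the `n`-element semiorders of length `H`. -/
def lengthProfiles (n H : ℕ) : Set (List ℕ) :=
  {t | t.length = n ∧ IsProfile n (t.getD · 0) ∧
    (∃ j < n, H ≤ rank (t.getD · 0) j) ∧ ∀ j < n, rank (t.getD · 0) j ≤ H}

theorem semiLen_profileOrder_iff {n H : ℕ} {F : ℕ → ℕ} (hF : IsProfile n F) :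
    SemiLen n H (profileOrder n F hF) ↔
      (∃ j < n, H ≤ rank F j) ∧ ∀ j < n, rank F j ≤ H := by
  have h1 := profileOrder_hasChain_iff hF H
  have h2 := profileOrder_hasChain_iff hF (H + 1)
  simp only [SemiLen, HasLength, profileOrder_isSemiorder hF, true_and]
  rw [h1, h2]
  simp only [not_exists, not_and, Nat.succ_le_iff, not_lt]

theorem fEx_eq_ncard (n H : ℕ) : fEx H n = (lengthProfiles n H).ncard := by
  rw [← Nat.card_coe_set_eq]
  symm
  let f : lengthProfiles n H → {P : PartialOrder (Fin n) // SemiLen n H P} := fun t =>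
    ⟨profileOrder n _ t.2.2.1, (semiLen_profileOrder_iff t.2.2.1).2 t.2.2.2⟩
  refine Nat.card_eq_of_bijective (fun t => Quot.mk _ (f t)) ⟨?_, ?_⟩
  · intro t t' h
    have hequiv : Equivalence (fun (P Q : {P : PartialOrder (Fin n) // SemiLen n H P}) =>
        ∃ e : Fin n ≃ Fin n, ∀ a b : Fin n, P.1.le a b ↔ Q.1.le (e a) (e b)) := by
      refine ⟨fun P => ⟨Equiv.refl _, fun a b => Iff.rfl⟩, ?_, ?_⟩
      · rintro P Q ⟨e, he⟩
        exact ⟨e.symm, fun a b => by rw [he]; simp⟩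
      · rintro P Q R ⟨e, he⟩ ⟨e', he'⟩
        exact ⟨e.trans e', fun a b => by rw [he, he']; rfl⟩
    obtain ⟨e, he⟩ := hequiv.eqvGen_iff.1 (Quot.eqvGen_exact h)
    apply Subtype.ext
    apply List.ext_getElem
    · rw [t.2.1, t'.2.1]
    · intro i h1 h2
      have := profile_eq_of_iso t.2.2.1 t'.2.2.1 e he (j := i) (by rw [← t.2.1]; exact h1)
      simpa [h1, h2] using this
  · rintro ⟨P, hP⟩
    obtain ⟨F, hF, e, he⟩ := @IsSemiorder.exists_profile _ P hP.1 n (Equiv.refl _)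
    have hG : ∀ j < n, (List.ofFn fun j : Fin n => F j).getD j 0 = F j := by
      intro j hj
      simp [hj]
    have hGP : IsProfile n ((List.ofFn fun j : Fin n => F j).getD · 0) := by
      refine ⟨fun a b hab hb => ?_, fun a ha => ?_⟩
      · simp only [hG a (by omega), hG b hb]
        exact hF.1 a b hab hb
      · simp only [hG a ha]
        exact hF.2 a ha
    have he' : ∀ a b, (profileOrder n _ hGP).le a b ↔ P.le (e a) (e b) := by
      intro a b
      rw [← he]
      change (a = b ∨ (a : ℕ) < (List.ofFn fun j : Fin n => F j).getD b 0) ↔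
        (a = b ∨ (a : ℕ) < F b)
      rw [hG b b.2]
    have hlen : SemiLen n H (profileOrder n _ hGP) := by
      refine ⟨profileOrder_isSemiorder hGP, ?_, fun h => ?_⟩
      · exact hasChain_of_iso (P := P) (Q := profileOrder n _ hGP) e.symm
          (fun a b => by rw [he']; simp) hP.2.1
      · exact hP.2.2 (hasChain_of_iso (P := profileOrder n _ hGP) (Q := P) e he' h)
    exact ⟨⟨List.ofFn fun j : Fin n => F j, by simp, hGP, (semiLen_profileOrder_iff hGP).1 hlen⟩,
      Quot.sound ⟨e, he'⟩⟩

theorem fEx_eq_coeff (n H : ℕ) (hn : 1 ≤ n) :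
    (fEx H n : ℤ) =
      PowerSeries.coeff n (dyckSeries (H + 1)) - PowerSeries.coeff n (dyckSeries H) := by
  rw [fEx_eq_ncard]
  cases H with
  | zero =>
    have hset : lengthProfiles n 0 = {t | t.length = n ∧ IsTail 0 0 0 0 t} := by
      ext t
      simp only [lengthProfiles, Set.mem_ofPred_eq]
      refine and_congr_right fun ht => ?_
      rw [isTail_zero_iff ht]
      exact and_congr_right fun _ => and_iff_right ⟨0, by omega, by omega⟩
    rw [hset, (hasCount_isTail_zero n 0).ncard_eq]
    simp [dyckSeries, PowerSeries.coeff_one, show n ≠ 0 by omega]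
  | succ H =>
    have hset : lengthProfiles n (H + 1) =
        {t | t.length = n ∧ IsTail (H + 1) 0 0 0 t} \ {t | t.length = n ∧ IsTail H 0 0 0 t} := by
      ext t
      simp only [lengthProfiles, Set.mem_ofPred_eq, Set.mem_sdiff]
      by_cases ht : t.length = n
      · simp only [ht, true_and, isTail_zero_iff ht]
        by_cases hF : IsProfile n (t.getD · 0)
        · simp only [hF, true_and, not_forall, not_le, Nat.succ_le_iff, exists_prop]
          exact and_comm
        · simp only [hF, false_and]
      · simp [ht]
    have hsub : {t : List ℕ | t.length = n ∧ IsTail H 0 0 0 t} ⊆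
        {t | t.length = n ∧ IsTail (H + 1) 0 0 0 t} := by
      rintro t ⟨ht, h⟩
      rw [isTail_zero_iff ht] at h
      exact ⟨ht, (isTail_zero_iff ht).2 ⟨h.1, fun j hj => (h.2 j hj).trans (Nat.le_succ H)⟩⟩
    have hcard := Set.ncard_sdiff_add_ncard_of_subset hsub (hasCount_isTail_zero n (H + 1)).finite
    rw [← (hasCount_isTail_zero n (H + 1)).ncard_eq, ← (hasCount_isTail_zero n H).ncard_eq,
      ← hcard, ← hset]
    push_cast
    rw [add_sub_cancel_right]

theorem statement5 (n H : ℕ) (hn : 1 ≤ n) :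
    fEx H n =
      Nat.card {l : List Bool // l.length = 2 * n ∧ IsDyckPath l ∧ DyckHeightIs l (H + 1)} := by
  exact_mod_cast (fEx_eq_coeff n H hn).trans (natCard_dyck_height n H).symm

end Paper
end

section
/- Let f_{≤h}^n denote the number of nonisomorphic n-element semiorders of length at most h, with f_{≤h}^0 = 1. Then for n ≥ 2 and h ≥ 1, f_{≤h}^n = Σ_{t=0}^{n−1} f_{≤h}^t · f_{≤(h−1)}^{n−1−t}. -/
namespace Paper

open PowerSeries

/-- `ParentSeq D v l`: new nodes are appended one by one to a forest whose nodes have remaining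
heights `D`; the entries of `l` are their parents, weakly increasing from `v` on. -/
def ParentSeq : List ℕ → ℕ → List ℕ → Prop
  | _, _, [] => True
  | D, v, x :: l => v ≤ x ∧ ∃ r, D[x]? = some (r + 1) ∧ ParentSeq (D ++ [r]) x l

/-- Generating function of plane forests of height at most `r`. -/
noncomputable def forestSeries : ℕ → ℚ⟦X⟧
  | 0 => 1
  | r + 1 => (1 - X * forestSeries r)⁻¹

theorem forestSeries_succ (r : ℕ) :
    forestSeries (r + 1) = 1 + X * (forestSeries r * forestSeries (r + 1)) := by
  have h : (1 - X * forestSeries r) * forestSeries (r + 1) = 1 := by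
    rw [forestSeries]
    exact PowerSeries.mul_inv_cancel _ (by simp)
  linear_combination h

theorem constantCoeff_forestSeries (r : ℕ) : constantCoeff (forestSeries r) = 1 := by
  cases r with
  | zero => simp [forestSeries]
  | succ r => rw [forestSeries_succ]; simp

theorem constantCoeff_prod_forestSeries (D : List ℕ) :
    constantCoeff (D.map forestSeries).prod = 1 := by
  induction D with
  | nil => simp
  | cons r D ih => simp [constantCoeff_forestSeries, ih]

/-- The parent sequences of length `m`. -/
def parentSeqs (D : List ℕ) (v m : ℕ) : Set (List ℕ) :=
  {l | l.length = m ∧ ParentSeq D v l}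

theorem parentSeqs_succ_of_getElem?_zero {D : List ℕ} {v m : ℕ} (h : D[v]? = some 0) :
    parentSeqs D v (m + 1) = parentSeqs D (v + 1) (m + 1) := by
  ext l
  cases l with
  | nil => simp [parentSeqs]
  | cons x l =>
    simp only [parentSeqs, Set.mem_ofPred_eq, ParentSeq]
    constructor
    · rintro ⟨h1, h2, r, h3, h4⟩
      refine ⟨h1, ?_, r, h3, h4⟩
      rcases h2.eq_or_lt with rfl | h2
      · simp [h] at h3
      · exact h2
    · rintro ⟨h1, h2, r, h3, h4⟩
      exact ⟨h1, by omega, r, h3, h4⟩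

theorem parentSeqs_succ_of_getElem?_succ {D : List ℕ} {v m r : ℕ} (h : D[v]? = some (r + 1)) :
    parentSeqs D v (m + 1) =
      parentSeqs D (v + 1) (m + 1) ∪ List.cons v '' parentSeqs (D ++ [r]) v m := by
  ext l
  cases l with
  | nil => simp [parentSeqs]
  | cons x l =>
    simp only [parentSeqs, Set.mem_ofPred_eq, ParentSeq, Set.mem_union, Set.mem_image,
      List.cons.injEq, List.length_cons, Nat.add_right_cancel_iff]
    constructor
    · rintro ⟨h1, h2, s, h3, h4⟩
      rcases h2.eq_or_lt with rfl | h2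
      · rw [h] at h3
        obtain rfl : r = s := by simpa using h3
        exact Or.inr ⟨l, ⟨h1, h4⟩, rfl, rfl⟩
      · exact Or.inl ⟨h1, h2, s, h3, h4⟩
    · rintro (⟨h1, h2, s, h3, h4⟩ | ⟨l', ⟨h1, h4⟩, rfl, rfl⟩)
      · exact ⟨h1, by omega, s, h3, h4⟩
      · exact ⟨h1, le_rfl, r, h, h4⟩

theorem parentSeqs_finite_and_ncard (m : ℕ) (D : List ℕ) (v : ℕ) :
    (parentSeqs D v m).Finite ∧
      ((parentSeqs D v m).ncard : ℚ) = coeff m ((D.drop v).map forestSeries).prod := by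
  induction m generalizing D v with
  | zero =>
    have : parentSeqs D v 0 = {[]} := by
      ext l
      cases l <;> simp [parentSeqs, ParentSeq]
    rw [this, coeff_zero_eq_constantCoeff_apply, constantCoeff_prod_forestSeries]
    simp
  | succ m ihm =>
    obtain ⟨k, hk⟩ : ∃ k, D.length - v = k := ⟨_, rfl⟩
    induction k generalizing v with
    | zero =>
      have : parentSeqs D v (m + 1) = ∅ := by
        ext l
        cases l with
        | nil => simp [parentSeqs]
        | cons x l =>
          simp only [parentSeqs, Set.mem_ofPred_eq, ParentSeq, Set.mem_empty_iff_false, iff_false]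
          rintro ⟨-, h2, r, h3, -⟩
          obtain ⟨h, -⟩ := List.getElem?_eq_some_iff.1 h3
          omega
      rw [this, List.drop_eq_nil_of_le (by omega)]
      simp [coeff_one]
    | succ k ihk =>
      have hv : v < D.length := by omega
      obtain ⟨fin1, card1⟩ := ihk (v + 1) (by omega)
      rw [List.drop_eq_getElem_cons hv, List.map_cons, List.prod_cons]
      rcases hr : D[v] with _ | r
      · rw [parentSeqs_succ_of_getElem?_zero (by rw [List.getElem?_eq_getElem hv, hr])]
        rw [forestSeries, one_mul]
        exact ⟨fin1, card1⟩
      · obtain ⟨fin2, card2⟩ := ihm (D ++ [r]) v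
        rw [parentSeqs_succ_of_getElem?_succ (by rw [List.getElem?_eq_getElem hv, hr])]
        have fin3 := fin2.image (List.cons v)
        refine ⟨fin1.union fin3, ?_⟩
        rw [Set.ncard_union_eq ?_ fin1 fin3, Set.ncard_image_of_injective _ List.cons_injective,
          Nat.cast_add, card1, card2, forestSeries_succ, List.drop_append_of_le_length hv.le,
          List.drop_eq_getElem_cons hv, hr]
        · rw [add_mul, map_add, one_mul, mul_assoc, coeff_succ_X_mul]
          simp only [List.map_append, List.map_cons, List.prod_append, List.prod_cons,
            List.map_nil, List.prod_nil, mul_one, List.cons_append]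
          congr 2
          ring
        · rw [Set.disjoint_left]
          rintro _ ⟨-, h⟩ ⟨l, -, rfl⟩
          simp only [ParentSeq] at h
          omega

theorem parentSeq_iff (D : List ℕ) (v : ℕ) (l : List ℕ) :
    ParentSeq D v l ↔ (∀ x ∈ l, v ≤ x) ∧ l.Pairwise (· ≤ ·) ∧
      ∃ ρ : ℕ → ℕ, (∀ i r, D[i]? = some r → ρ i = r) ∧
        ∀ j (hj : j < l.length), l[j] < D.length + j ∧ ρ l[j] = ρ (D.length + j) + 1 := by
  induction l generalizing D v with
  | nil =>
    simp only [ParentSeq, true_iff]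
    refine ⟨by simp, by simp, fun i => D.getD i 0, fun i r h => by simp [h], by simp⟩
  | cons x l ih =>
    simp only [ParentSeq, ih, List.mem_cons, List.pairwise_cons]
    constructor
    · rintro ⟨hvx, r, hr, hxl, hl, ρ, hρ, hρl⟩
      obtain ⟨hx, -⟩ := List.getElem?_eq_some_iff.1 hr
      refine ⟨?_, ⟨hxl, hl⟩, ρ, ?_, ?_⟩
      · rintro y (rfl | hy)
        · exact hvx
        · exact hvx.trans (hxl y hy)
      · intro i s hs
        obtain ⟨hi, -⟩ := List.getElem?_eq_some_iff.1 hs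
        exact hρ i s (by rw [List.getElem?_append_left hi, hs])
      · rintro (_ | j) hj
        · refine ⟨hx, ?_⟩
          rw [List.getElem_cons_zero, add_zero, hρ D.length r (by simp)]
          exact hρ x _ (by rw [List.getElem?_append_left hx, hr])
        · have := hρl j (by simpa using hj)
          simpa [add_assoc, add_comm 1 j] using this
    · rintro ⟨hv, ⟨hxl, hl⟩, ρ, hρ, hρl⟩
      have h0 := hρl 0 (by simp)
      simp only [List.getElem_cons_zero, Nat.add_zero] at h0
      refine ⟨hv x (Or.inl rfl), ρ D.length, ?_, hxl, hl, ρ, ?_, ?_⟩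
      · rw [← h0.2, hρ x _ (List.getElem?_eq_getElem h0.1), List.getElem?_eq_getElem]
      · intro i r hi
        rcases lt_or_ge i D.length with h | h
        · exact hρ i r (by rwa [List.getElem?_append_left h] at hi)
        · obtain ⟨hi', -⟩ := List.getElem?_eq_some_iff.1 hi
          obtain rfl : i = D.length := by simp at hi'; omega
          simpa using hi
      · intro j hj
        have := hρl (j + 1) (by simpa using hj)
        simpa [add_assoc, add_comm 1 j] using this

/-- `f` codes a semiorder whose elements are suitably numbered: `i` is below `j` iff `i < f j`. -/
structure IsCode {n : ℕ} (f : Fin n → ℕ) : Prop where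
  mono : Monotone f
  le : ∀ j, f j ≤ j

/-- A chain of `k` elements in the semiorder coded by `f`. -/
def CodeChain {n : ℕ} (f : Fin n → ℕ) (k : ℕ) : Prop :=
  ∃ c : Fin k → Fin n, ∀ i j, i < j → (c i : ℕ) < f (c j)

theorem CodeChain.mono {n : ℕ} {f : Fin n → ℕ} {k l : ℕ} (h : CodeChain f l) (hkl : k ≤ l) :
    CodeChain f k := by
  obtain ⟨c, hc⟩ := h
  exact ⟨fun i => c (Fin.castLE hkl i), fun i j hij => hc _ _ (by simpa using hij)⟩

/-- Length of the longest chain among the first `j` elements of a coded semiorder. -/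
def codeDepth (F : ℕ → ℕ) : ℕ → ℕ
  | 0 => 0
  | j + 1 => codeDepth F (min (F j) j) + 1

theorem exists_chain_codeDepth {n : ℕ} {f : Fin n → ℕ} (hf : IsCode f) {F : ℕ → ℕ}
    (hF : ∀ j : Fin n, F j = f j) (j : ℕ) (hj : j ≤ n) :
    ∃ c : Fin (codeDepth F j) → Fin n,
      (∀ i i', i < i' → (c i : ℕ) < f (c i')) ∧ ∀ i, (c i : ℕ) < j := by
  induction j using Nat.strong_induction_on with
  | _ j ih =>
    cases j with
    | zero => exact ⟨fun i => (by simpa [codeDepth] using i.2 : False).elim,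
        fun i => (by simpa [codeDepth] using i.2 : False).elim,
        fun i => (by simpa [codeDepth] using i.2 : False).elim⟩
    | succ j =>
      have hFj := hF ⟨j, hj⟩
      have hle := hf.le ⟨j, hj⟩
      simp only at hFj hle
      rw [codeDepth, min_eq_left (by omega)]
      obtain ⟨c, hc, hcj⟩ := ih (F j) (by omega) (by omega)
      refine ⟨Fin.snoc (α := fun _ => Fin n) c ⟨j, hj⟩, ?_, ?_⟩
      · intro i i' hii
        induction i' using Fin.lastCases with
        | last =>
          induction i using Fin.lastCases with
          | last => simp at hii
          | cast i => simpa [← hFj] using hcj i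
        | cast i' =>
          induction i using Fin.lastCases with
          | last => exact absurd hii (Fin.le_last _).not_gt
          | cast i => simpa using hc i i' (by simpa using hii)
      · intro i
        induction i using Fin.lastCases with
        | last => simp
        | cast i =>
          have := hcj i
          simp only [Fin.snoc_castSucc]
          omega

theorem antitone_of_code {n : ℕ} {f : Fin n → ℕ} (hf : IsCode f) {ρ : ℕ → ℕ}
    (hρ : ∀ j : Fin n, ρ (f j) = ρ (j + 1) + 1) (b : ℕ) (hb : b ≤ n) (a : ℕ) (hab : a ≤ b) :
    ρ b ≤ ρ a := by
  induction b using Nat.strong_induction_on generalizing a with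
  | _ b ih =>
    cases b with
    | zero => simp [Nat.le_zero.1 hab]
    | succ b =>
      have hb1 := hρ ⟨b, hb⟩
      have hb2 := hf.le ⟨b, hb⟩
      simp only at hb1 hb2
      cases a with
      | zero =>
        have := ih (f ⟨b, hb⟩) (by omega) (by omega) 0 (by omega)
        omega
      | succ a =>
        have ha1 := hρ ⟨a, by omega⟩
        have := ih (f ⟨b, hb⟩) (by omega) (by omega) (f ⟨a, by omega⟩)
          (hf.mono (by simpa using hab))
        simp only at ha1
        omega

theorem not_codeChain_iff {n : ℕ} {f : Fin n → ℕ} (hf : IsCode f) (H : ℕ) :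
    ¬ CodeChain f (H + 1) ↔ ∃ ρ : ℕ → ℕ, ρ 0 = H ∧ ∀ j : Fin n, ρ (f j) = ρ (j + 1) + 1 := by
  constructor
  · intro h
    let F : ℕ → ℕ := fun j => if hj : j < n then f ⟨j, hj⟩ else 0
    have hF : ∀ j : Fin n, F j = f j := fun j => by simp [F]
    have hd : ∀ j ≤ n, codeDepth F j ≤ H := by
      intro j hj
      by_contra! hlt
      obtain ⟨c, hc, -⟩ := exists_chain_codeDepth hf hF j hj
      exact h (CodeChain.mono ⟨c, hc⟩ hlt)
    refine ⟨fun j => H - codeDepth F j, by simp [codeDepth], fun j => ?_⟩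
    have h1 := hd (j + 1) j.2
    rw [codeDepth, hF, min_eq_left (hf.le j)] at h1
    simp only
    rw [codeDepth, hF, min_eq_left (hf.le j)]
    omega
  · rintro ⟨ρ, h0, hρ⟩ ⟨c, hc⟩
    have key : ∀ i (hi : i < H + 1), ρ (c ⟨i, hi⟩ + 1) + i + 1 ≤ H := by
      intro i
      induction i with
      | zero =>
        intro hi
        have h1 := hρ (c ⟨0, hi⟩)
        have h2 := antitone_of_code hf hρ (f (c ⟨0, hi⟩)) ((hf.le _).trans (c _).2.le) 0
          (Nat.zero_le _)
        omega
      | succ i ih =>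
        intro hi
        have h0 := ih (by omega)
        have h1 := hρ (c ⟨i + 1, hi⟩)
        have h2 := antitone_of_code hf hρ (f (c ⟨i + 1, hi⟩)) ((hf.le _).trans (c _).2.le)
          (c ⟨i, by omega⟩ + 1) (hc _ _ (by simp))
        omega
    have := key H (by omega)
    omega

theorem parentSeq_singleton_iff {n : ℕ} (f : Fin n → ℕ) (H : ℕ) :
    ParentSeq [H] 0 (List.ofFn f) ↔ IsCode f ∧ ¬ CodeChain f (H + 1) := by
  have hp : (List.ofFn f).Pairwise (· ≤ ·) ↔ Monotone f := by
    rw [List.pairwise_ofFn, monotone_iff_forall_lt]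
  rw [parentSeq_iff, hp]
  constructor
  · rintro ⟨-, hm, ρ, h0, hρ⟩
    have hf : IsCode f := ⟨hm, fun j => by
      have := (hρ j (by simp)).1
      simp at this
      omega⟩
    refine ⟨hf, (not_codeChain_iff hf H).2 ⟨ρ, h0 0 H (by simp), fun j => ?_⟩⟩
    simpa [add_comm] using (hρ j (by simp)).2
  · rintro ⟨hf, hc⟩
    obtain ⟨ρ, h0, hρ⟩ := (not_codeChain_iff hf H).1 hc
    refine ⟨by simp, hf.mono, ρ, ?_, ?_⟩
    · rintro (_ | i) r hr
      · simpa [h0] using hr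
      · simp at hr
    · intro j hj
      simp only [List.length_ofFn] at hj
      have h1 := hf.le ⟨j, hj⟩
      have h2 := hρ ⟨j, hj⟩
      simp only at h1 h2
      simp only [List.getElem_ofFn, List.length_singleton]
      rw [add_comm 1 j]
      exact ⟨by omega, h2⟩

/-- The numbering `e` realises the poset `α` as the one coded by `f`. -/
def Codes {α : Type*} [PartialOrder α] {n : ℕ} (e : Fin n ≃ α) (f : Fin n → ℕ) : Prop :=
  ∀ i j, e i < e j ↔ (i : ℕ) < f j

theorem Codes.hasChain_iff {α : Type*} [PartialOrder α] {n : ℕ} {e : Fin n ≃ α} {f : Fin n → ℕ}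
    (he : Codes e f) (k : ℕ) : HasChain α k ↔ CodeChain f k := by
  constructor
  · rintro ⟨c, hc⟩
    exact ⟨fun i => e.symm (c i), fun i j hij => (he _ _).1 (by simpa using hc hij)⟩
  · rintro ⟨c, hc⟩
    exact ⟨fun i => e (c i), fun i j hij => (he _ _).2 (hc i j hij)⟩

theorem Codes.isSemiorder {α : Type*} [PartialOrder α] {n : ℕ} {e : Fin n ≃ α} {f : Fin n → ℕ}
    (he : Codes e f) (hf : IsCode f) : IsSemiorder α := by
  have lt_iff : ∀ a b : α, a < b ↔ (e.symm a : ℕ) < f (e.symm b) := fun a b => by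
    simpa using he (e.symm a) (e.symm b)
  constructor
  · rintro ⟨x, y, z, w, hyx, hwz, -, hxw, hyz, -⟩
    have h1 : ¬ y < z := fun h => hyz.1 h.le
    have h2 : ¬ w < x := fun h => hxw.2 h.le
    rw [lt_iff] at *
    omega
  · rintro ⟨x, y, z, w, hzy, hyx, hxw, -, hzw⟩
    have h1 : ¬ w < x := fun h => hxw.2 h.le
    have h2 : ¬ z < w := fun h => hzw.1 h.le
    rw [lt_iff] at *
    have := hf.mono (show e.symm y ≤ e.symm w from by rw [Fin.le_def]; omega)
    omega

theorem card_filter_val_lt {n m : ℕ} (h : m ≤ n) :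
    (Finset.univ.filter fun i : Fin n => (i : ℕ) < m).card = m := by
  rw [Fin.card_filter_val_lt, min_eq_right h]

section Semiorder

variable {α : Type*} [PartialOrder α]

theorem IsSemiorder.Iio_total (h : IsSemiorder α) (a b : α) :
    Set.Iio a ⊆ Set.Iio b ∨ Set.Iio b ⊆ Set.Iio a := by
  by_contra! hc
  obtain ⟨⟨y, hya, hyb⟩, ⟨w, hwb, hwa⟩⟩ := hc.imp Set.not_subset.1 Set.not_subset.1
  simp only [Set.mem_Iio] at *
  refine h.1 ⟨a, y, b, w, hya, hwb, ⟨?_, ?_⟩, ⟨?_, ?_⟩, ⟨?_, ?_⟩, ⟨?_, ?_⟩⟩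
  · exact fun h => hyb (hya.trans_le h)
  · exact fun h => hwa (hwb.trans_le h)
  · exact fun h => hyb (hya.trans (h.trans_lt hwb))
  · intro h
    rcases h.eq_or_lt with rfl | h
    · exact hyb (hya.trans hwb)
    · exact hwa h
  · intro h
    rcases h.eq_or_lt with rfl | h
    · exact hwa (hwb.trans hya)
    · exact hyb h
  · exact fun h => hwa (hwb.trans_le (h.trans hya.le))
  · exact fun h => hyb (h.trans_lt hwb)
  · exact fun h => hwa (h.trans_lt hya)

theorem IsSemiorder.Ioi_subset (h : IsSemiorder α) {a b z : α} (hzb : z < b) (hza : ¬ z < a) :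
    Set.Ioi b ⊆ Set.Ioi a := by
  intro x hbx
  simp only [Set.mem_Ioi] at *
  by_contra hax
  refine h.2 ⟨x, b, z, a, hzb, hbx, ⟨?_, ?_⟩, ⟨?_, ?_⟩, ⟨?_, ?_⟩⟩
  · exact fun h => hza (hzb.trans (hbx.trans_le h))
  · intro h
    rcases h.eq_or_lt with rfl | h
    · exact hza (hzb.trans hbx)
    · exact hax h
  · exact fun h => hza (hzb.trans_le h)
  · exact fun h => hax (h.trans_lt hbx)
  · intro h
    rcases h.eq_or_lt with rfl | h
    · exact hax (hzb.trans hbx)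
    · exact hza h
  · exact fun h => hax (h.trans_lt (hzb.trans hbx))

theorem IsSemiorder.Ioi_total (h : IsSemiorder α) (a b : α) :
    Set.Ioi a ⊆ Set.Ioi b ∨ Set.Ioi b ⊆ Set.Ioi a := by
  by_contra! hc
  obtain ⟨⟨y, hya, hyb⟩, ⟨w, hwb, hwa⟩⟩ := hc.imp Set.not_subset.1 Set.not_subset.1
  rcases h.Iio_total y w with h' | h'
  · exact hwa (h' hya)
  · exact hyb (h' hwb)

/-- Sorting the elements of a semiorder by this key arranges all down-sets and up-sets. -/
noncomputable def sortKey (a : α) : ℤ := (Set.Iio a).ncard - (Set.Ioi a).ncard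

theorem IsSemiorder.Iio_subset_of_sortKey_le [Finite α] (h : IsSemiorder α) {a b : α}
    (hab : sortKey a ≤ sortKey b) : Set.Iio a ⊆ Set.Iio b := by
  by_contra hc
  obtain ⟨z, hza, hzb⟩ := Set.not_subset.1 hc
  have h1 := Set.ncard_lt_ncard (((h.Iio_total a b).resolve_left hc).ssubset_of_not_subset hc)
  have h2 := Set.ncard_le_ncard (h.Ioi_subset hza hzb)
  unfold sortKey at hab
  omega

theorem IsSemiorder.Ioi_subset_of_sortKey_le [Finite α] (h : IsSemiorder α) {a b : α}
    (hab : sortKey a ≤ sortKey b) : Set.Ioi b ⊆ Set.Ioi a := by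
  by_contra hc
  have h1 := Set.ncard_lt_ncard (((h.Ioi_total a b).resolve_right hc).ssubset_of_not_subset hc)
  have h2 : Set.Iio b ⊆ Set.Iio a := fun z hzb => by_contra fun hza => hc (h.Ioi_subset hzb hza)
  have h3 := Set.ncard_le_ncard h2
  unfold sortKey at hab
  omega

theorem IsSemiorder.exists_codes (h : IsSemiorder α) {n : ℕ} (e₀ : Fin n ≃ α) :
    ∃ (e : Fin n ≃ α) (f : Fin n → ℕ), IsCode f ∧ Codes e f := by
  have : Finite α := Finite.of_equiv _ e₀
  let e : Fin n ≃ α := (Tuple.sort (sortKey ∘ e₀)).trans e₀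
  have hmono : Monotone (sortKey ∘ e) := Tuple.monotone_sort (sortKey ∘ e₀)
  have hcodes : Codes e fun j => (Set.Iio (e j)).ncard := by
    intro i j
    have hlower : ∀ a b : Fin n, a ≤ b → e b < e j → e a < e j := fun a b hab hb =>
      h.Ioi_subset_of_sortKey_le (hmono hab) hb
    have hcard : (Set.Iio (e j)).ncard = {a : Fin n | e a < e j}.ncard := by
      rw [← Set.ncard_image_of_injective _ e.injective]
      congr 1
      ext x
      simp only [Set.mem_Iio, Set.mem_image, Set.mem_ofPred_eq]
      exact ⟨fun hx => ⟨e.symm x, by simpa using hx, by simp⟩, by rintro ⟨a, ha, rfl⟩; exact ha⟩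
    simp only [hcard]
    constructor
    · intro hi
      have h1 : Set.Iic i ⊆ {a : Fin n | e a < e j} := fun a ha => hlower a i ha hi
      have h2 := Set.ncard_le_ncard h1
      rw [Set.ncard_eq_toFinset_card', Set.toFinset_Iic, Fin.card_Iic] at h2
      omega
    · intro hi
      by_contra hc
      have h1 : {a : Fin n | e a < e j} ⊆ Set.Iio i := fun a ha => by
        by_contra hia
        exact hc (hlower i a (not_lt.1 hia) ha)
      have h2 := Set.ncard_le_ncard h1
      rw [Set.ncard_eq_toFinset_card' (Set.Iio i), Set.toFinset_Iio, Fin.card_Iio] at h2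
      omega
  refine ⟨e, _, ⟨?_, ?_⟩, hcodes⟩
  · exact fun i j hij => Set.ncard_le_ncard (h.Iio_subset_of_sortKey_le (hmono hij))
  · exact fun j => not_lt.1 fun hj => lt_irrefl _ ((hcodes j j).2 hj)

end Semiorder

/-- The semiorder coded by `f`. -/
abbrev IsCode.order {n : ℕ} {f : Fin n → ℕ} (hf : IsCode f) : PartialOrder (Fin n) where
  le i j := i = j ∨ (i : ℕ) < f j
  lt i j := (i : ℕ) < f j
  le_refl i := Or.inl rfl
  le_trans i j k := by
    rintro (rfl | hij) (rfl | hjk)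
    · exact Or.inl rfl
    · exact Or.inr hjk
    · exact Or.inr hij
    · exact Or.inr (by have := hf.le j; omega)
  le_antisymm i j := by
    rintro (rfl | hij) (h | hji)
    · rfl
    · rfl
    · exact h.symm
    · have := hf.le j
      have := hf.le i
      omega
  lt_iff_le_not_ge i j := by
    have h1 := hf.le j
    have h2 := hf.le i
    constructor
    · intro h
      refine ⟨Or.inr h, ?_⟩
      rintro (rfl | h') <;> omega
    · rintro ⟨rfl | h, h'⟩
      · exact absurd (Or.inl rfl) h'
      · exact h

theorem IsCode.codes {n : ℕ} {f : Fin n → ℕ} (hf : IsCode f) :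
    @Codes _ hf.order _ (Equiv.refl _) f := fun _ _ => Iff.rfl

theorem IsCode.semiLenLe {n h : ℕ} {f : Fin n → ℕ} (hf : IsCode f)
    (hc : ¬ CodeChain f (h + 2)) : SemiLenLe n h hf.order :=
  ⟨@Codes.isSemiorder _ hf.order _ _ _ hf.codes hf,
    fun hch => hc ((@Codes.hasChain_iff _ hf.order _ _ _ hf.codes _).1 hch)⟩

/-- The isomorphism relation identifying two partial orders on `Fin n`. -/
def OrderIsoRel {n : ℕ} (P Q : PartialOrder (Fin n)) : Prop :=
  ∃ e : Fin n ≃ Fin n, ∀ a b : Fin n,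
    (@LE.le _ P.toPreorder.toLE a b ↔ @LE.le _ Q.toPreorder.toLE (e a) (e b))

theorem orderIsoRel_equivalence (n : ℕ) : Equivalence (@OrderIsoRel n) where
  refl _ := ⟨Equiv.refl _, fun _ _ => Iff.rfl⟩
  symm := by
    rintro P Q ⟨e, he⟩
    exact ⟨e.symm, fun a b => by simpa using (he (e.symm a) (e.symm b)).symm⟩
  trans := by
    rintro P Q R ⟨e, he⟩ ⟨e', he'⟩
    exact ⟨e.trans e', fun a b => (he a b).trans (he' _ _)⟩

theorem IsCode.eq_of_orderIsoRel {n : ℕ} {f g : Fin n → ℕ} (hf : IsCode f) (hg : IsCode g)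
    (h : OrderIsoRel hf.order hg.order) : f = g := by
  obtain ⟨e, he⟩ := h
  have hlt : ∀ i j : Fin n, (i : ℕ) < f j ↔ (e i : ℕ) < g (e j) := fun i j => by
    have h1 := @lt_iff_le_not_ge _ hf.order.toPreorder i j
    have h2 := @lt_iff_le_not_ge _ hg.order.toPreorder (e i) (e j)
    rw [he, he] at h1
    exact h1.trans h2.symm
  have hfg : f = g ∘ e := by
    funext j
    rw [Function.comp_apply, ← card_filter_val_lt ((hf.le j).trans j.2.le),
      ← card_filter_val_lt ((hg.le (e j)).trans (e j).2.le)]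
    exact Finset.card_equiv e fun i => by simp [hlt]
  have := Tuple.unique_monotone (f := g) (σ := e) (τ := Equiv.refl _)
    (hfg ▸ hf.mono) hg.mono
  rw [hfg, this]
  rfl

theorem fLe_eq_ncard (h n : ℕ) : fLe h n = (parentSeqs [h + 1] 0 n).ncard := by
  have hcode : ∀ l : parentSeqs [h + 1] 0 n, ∃ f : Fin n → ℕ,
      List.ofFn f = l ∧ IsCode f ∧ ¬ CodeChain f (h + 2) := by
    rintro ⟨l, rfl, hl⟩
    refine ⟨l.get, List.ofFn_get l, (parentSeq_singleton_iff l.get (h + 1)).1 ?_⟩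
    rwa [List.ofFn_get]
  choose f hfl hf hc using hcode
  symm
  unfold fLe countPosets
  rw [← Nat.card_coe_set_eq]
  refine Nat.card_congr (Equiv.ofBijective
    (fun l => Quot.mk _ ⟨(hf l).order, (hf l).semiLenLe (hc l)⟩) ⟨?_, ?_⟩)
  · intro l l' hll
    have hrel := (Equivalence.comap (orderIsoRel_equivalence n) Subtype.val).quot_mk_eq_iff
      _ _ |>.1 hll
    have := (hf l).eq_of_orderIsoRel (hf l') hrel
    rw [Subtype.ext_iff, ← hfl l, ← hfl l', this]
  · rintro ⟨⟨P, hP, hPc⟩⟩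
    obtain ⟨e, g, hg, he⟩ := @IsSemiorder.exists_codes _ P hP n (Equiv.refl _)
    have hgc : ¬ CodeChain g (h + 2) := fun hch =>
      hPc ((@Codes.hasChain_iff _ P _ _ _ he _).2 hch)
    let l : parentSeqs [h + 1] 0 n :=
      ⟨List.ofFn g, by simp, (parentSeq_singleton_iff g (h + 1)).2 ⟨hg, hgc⟩⟩
    have hl : f l = g := List.ofFn_injective (hfl l)
    refine ⟨l, Quot.sound ⟨e, fun a b => ?_⟩⟩
    have h1 := @le_iff_eq_or_lt _ P (e a) (e b)
    rw [he a b, e.injective.eq_iff] at h1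
    rw [h1, ← hl]
    exact Iff.rfl

theorem fLe_eq_coeff (h n : ℕ) : (fLe h n : ℚ) = coeff n (forestSeries (h + 1)) := by
  rw [fLe_eq_ncard, (parentSeqs_finite_and_ncard n _ _).2]
  simp

theorem statement6 (n h : ℕ) (hn : 2 ≤ n) (hh : 1 ≤ h) :
    fLe h n = ∑ t ∈ Finset.range n, fLe h t * fLe (h - 1) (n - 1 - t) := by
  obtain ⟨n, rfl⟩ : ∃ m, n = m + 1 := ⟨n - 1, by omega⟩
  obtain ⟨h, rfl⟩ : ∃ k, h = k + 1 := ⟨h - 1, by omega⟩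
  rw [← Nat.cast_inj (R := ℚ)]
  push_cast
  simp only [fLe_eq_coeff]
  have hcoeff : coeff (n + 1) (forestSeries (h + 1 + 1)) =
      coeff n (forestSeries (h + 1 + 1) * forestSeries (h + 1)) := by
    conv_lhs => rw [forestSeries_succ]
    rw [map_add, coeff_succ_X_mul, coeff_one, if_neg (by omega), zero_add, mul_comm]
  rw [hcoeff, coeff_mul, Finset.Nat.sum_antidiagonal_eq_sum_range_succ_mk]

end Paper
end

section
/- The number of nonisomorphic unlabeled n-element semiorders of length at most one is 2^{n−1}, for n ≥ 1. -/
namespace Paper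

/-- The number of elements strictly below `a`. -/
noncomputable def downDegree {α : Type*} [Preorder α] (a : α) : ℕ := (Set.Iio a).ncard

/-- The number of non-minimal elements of down-degree at most `c`. -/
noncomputable def upperCount (α : Type*) [Preorder α] (c : ℕ) : ℕ :=
  {a : α | 0 < downDegree a ∧ downDegree a ≤ c}.ncard

/-- An isomorphism invariant of `α`: the positions of the letter `false` in the word of `α`. -/
noncomputable def zeroPositions (α : Type*) [Preorder α] : Finset ℕ :=
  (Finset.range {a : α | downDegree a = 0}.ncard).image fun c => c + upperCount α c

/-- `e` identifies `α` with the poset of the word `w`, in which the letters `false` are the lower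
elements, the letters `true` the upper ones, and a lower element is below the upper elements to its
right. -/
def IsWordOf {α : Type*} [Preorder α] {n : ℕ} (w : Fin n → Bool) (e : Fin n ≃ α) : Prop :=
  ∀ i j, e i < e j ↔ i < j ∧ w i = false ∧ w j = true

/-- The poset of a word. -/
@[reducible]
def wordOrder {n : ℕ} (w : Fin n → Bool) : PartialOrder (Fin n) where
  le i j := i = j ∨ (i < j ∧ w i = false ∧ w j = true)
  lt i j := i < j ∧ w i = false ∧ w j = true
  le_refl _ := Or.inl rfl
  lt_iff_le_not_ge := by grind
  le_trans := by grind
  le_antisymm := by grind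

theorem isWordOf_wordOrder {n : ℕ} (w : Fin n → Bool) :
    @IsWordOf (Fin n) (wordOrder w).toPreorder n w (Equiv.refl _) :=
  fun _ _ => Iff.rfl

theorem hasChain_three_iff {α : Type*} [Preorder α] :
    HasChain α 3 ↔ ∃ a b c : α, a < b ∧ b < c := by
  constructor
  · rintro ⟨c, hc⟩
    exact ⟨c 0, c 1, c 2, hc (by decide), hc (by decide)⟩
  · rintro ⟨a, b, c, hab, hbc⟩
    refine ⟨![a, b, c], Fin.strictMono_iff_lt_succ.2 fun i => ?_⟩
    fin_cases i
    · exact hab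
    · exact hbc

theorem IsWordOf.not_hasChain_three {α : Type*} [Preorder α] {n : ℕ} {w : Fin n → Bool}
    {e : Fin n ≃ α} (h : IsWordOf w e) : ¬ HasChain α 3 := by
  rw [hasChain_three_iff]
  rintro ⟨a, b, c, hab, hbc⟩
  obtain ⟨i, rfl⟩ := e.surjective a
  obtain ⟨j, rfl⟩ := e.surjective b
  obtain ⟨k, rfl⟩ := e.surjective c
  rw [h] at hab hbc
  simp [hab.2.2] at hbc

theorem IsWordOf.isSemiorder {α : Type*} [PartialOrder α] {n : ℕ} {w : Fin n → Bool}
    {e : Fin n ≃ α} (h : IsWordOf w e) : IsSemiorder α := by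
  constructor
  · rintro ⟨x, y, z, t, hyx, htz, -, hxt, hyz, -⟩
    have hyz' : ¬ y < z := fun hlt => hyz.1 hlt.le
    have htx' : ¬ t < x := fun hlt => hxt.2 hlt.le
    obtain ⟨i, rfl⟩ := e.surjective x
    obtain ⟨j, rfl⟩ := e.surjective y
    obtain ⟨k, rfl⟩ := e.surjective z
    obtain ⟨l, rfl⟩ := e.surjective t
    rw [h] at hyx htz hyz' htx'
    grind
  · rintro ⟨x, y, z, -, hzy, hyx, -⟩
    exact h.not_hasChain_three (hasChain_three_iff.2 ⟨z, y, x, hzy, hyx⟩)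

theorem downDegree_orderIso {α β : Type*} [Preorder α] [Preorder β] (e : α ≃o β) (a : α) :
    downDegree (e a) = downDegree a := by
  rw [downDegree, downDegree, ← e.image_Iio, Set.ncard_image_of_injective _ e.injective]

theorem ncard_downDegree_congr {α β : Type*} [Preorder α] [Preorder β] (e : α ≃o β)
    (p : ℕ → Prop) : {a : α | p (downDegree a)}.ncard = {b : β | p (downDegree b)}.ncard := by
  rw [← Set.ncard_image_of_injective _ e.injective]
  congr 1
  ext b
  obtain ⟨a, rfl⟩ := e.surjective b
  simp [downDegree_orderIso]

theorem zeroPositions_congr {α β : Type*} [Preorder α] [Preorder β] (e : α ≃o β) :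
    zeroPositions α = zeroPositions β := by
  have hu : upperCount α = upperCount β :=
    funext fun c => ncard_downDegree_congr e fun d => 0 < d ∧ d ≤ c
  rw [zeroPositions, zeroPositions, hu, ncard_downDegree_congr e fun d => d = 0]

section Word

variable {α : Type*} [Preorder α] {m : ℕ} {w : Fin (m + 1) → Bool} {e : Fin (m + 1) ≃ α}

theorem IsWordOf.downDegree_of_false (h : IsWordOf w e) {j : Fin (m + 1)} (hj : w j = false) :
    downDegree (e j) = 0 := by
  have hempty : Set.Iio (e j) = ∅ := by
    ext b
    obtain ⟨i, rfl⟩ := e.surjective b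
    simp [h i j, hj]
  rw [downDegree, hempty, Set.ncard_empty]

theorem IsWordOf.downDegree_of_true (h : IsWordOf w e) {j : Fin (m + 1)} (hj : w j = true) :
    downDegree (e j) = (Finset.univ.filter fun i => i < j ∧ w i = false).card := by
  have himage : Set.Iio (e j) =
      e '' ((Finset.univ.filter fun i => i < j ∧ w i = false : Finset (Fin (m + 1))) : Set _) := by
    ext b
    obtain ⟨i, rfl⟩ := e.surjective b
    simp [h i j, hj]
  rw [downDegree, himage, Set.ncard_image_of_injective _ e.injective, Set.ncard_coe_finset]

theorem IsWordOf.downDegree_pos_iff (h : IsWordOf w e) (h0 : w 0 = false) (j : Fin (m + 1)) :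
    0 < downDegree (e j) ↔ w j = true := by
  cases hj : w j
  · simp [h.downDegree_of_false hj]
  · rw [h.downDegree_of_true hj, Finset.card_pos]
    refine iff_of_true ⟨0, ?_⟩ rfl
    have hne : j ≠ 0 := by rintro rfl; simp [h0] at hj
    simp [h0, Fin.pos_iff_ne_zero.2 hne]

theorem IsWordOf.ncard_downDegree_eq_zero (h : IsWordOf w e) (h0 : w 0 = false) :
    {a : α | downDegree a = 0}.ncard = (Finset.univ.filter fun i => w i = false).card := by
  have himage : {a : α | downDegree a = 0} =
      e '' ((Finset.univ.filter fun i => w i = false : Finset (Fin (m + 1))) : Set _) := by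
    ext b
    obtain ⟨i, rfl⟩ := e.surjective b
    have := h.downDegree_pos_iff h0 i
    simp
    grind
  rw [himage, Set.ncard_image_of_injective _ e.injective, Set.ncard_coe_finset]

theorem IsWordOf.upperCount_eq (h : IsWordOf w e) (h0 : w 0 = false) {i : Fin (m + 1)}
    (hi : w i = false) :
    upperCount α (Finset.univ.filter fun k => k < i ∧ w k = false).card =
      (Finset.univ.filter fun k => k < i ∧ w k = true).card := by
  rw [upperCount, ← Set.ncard_coe_finset (Finset.univ.filter fun k => k < i ∧ w k = true),
    ← Set.ncard_image_of_injective (SetLike.coe (Finset.univ.filter fun k => k < i ∧ w k = true)) e.injective]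
  congr 1
  ext b
  obtain ⟨k, rfl⟩ := e.surjective b
  rw [e.injective.mem_set_image]
  simp only [Set.mem_ofPred_eq, h.downDegree_pos_iff h0, Finset.coe_filter, Finset.mem_univ,
    true_and]
  rw [and_comm]
  refine and_congr_left fun hk => ?_
  rw [h.downDegree_of_true hk]
  constructor
  · intro hle
    by_contra hik
    refine absurd hle (not_le.2 (Finset.card_lt_card ?_))
    rw [Finset.ssubset_iff_of_subset (fun l hl => by grind)]
    exact ⟨i, by grind, by simp⟩
  · intro hki
    exact Finset.card_le_card fun l hl => by grind

theorem IsWordOf.zeroPositions_eq (h : IsWordOf w e) (h0 : w 0 = false) :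
    zeroPositions α = (Finset.univ.filter fun i => w i = false).image Fin.val := by
  symm
  refine Finset.eq_of_subset_of_card_le ?_ ?_
  · intro p hp
    obtain ⟨i, hi, rfl⟩ := Finset.mem_image.1 hp
    replace hi : w i = false := by simpa using hi
    refine Finset.mem_image.2 ⟨(Finset.univ.filter fun k => k < i ∧ w k = false).card, ?_, ?_⟩
    · rw [Finset.mem_range, h.ncard_downDegree_eq_zero h0]
      refine Finset.card_lt_card ?_
      rw [Finset.ssubset_iff_of_subset (fun l hl => by grind)]
      exact ⟨i, by simpa using hi, by simp⟩
    · rw [h.upperCount_eq h0 hi, ← Finset.card_union_of_disjoint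
        (Finset.disjoint_left.2 fun k hk hk' => by grind), ← Fin.card_Iio i]
      congr 1
      ext k
      cases hk : w k <;> simp [hk]
  · rw [Finset.card_image_of_injective _ Fin.val_injective, ← h.ncard_downDegree_eq_zero h0]
    exact Finset.card_image_le.trans_eq (Finset.card_range _)

end Word

theorem IsSemiorder.lt_or_lt {α : Type*} [PartialOrder α] (h : IsSemiorder α) {x y x' y' : α}
    (hxy : x < y) (hxy' : x' < y') : x < y' ∨ x' < y := by
  by_contra! hcon
  obtain ⟨h₁, h₂⟩ := hcon
  refine h.1 ⟨y, x, y', x', hxy, hxy', ⟨?_, ?_⟩, ⟨?_, ?_⟩, ⟨?_, ?_⟩, ⟨?_, ?_⟩⟩ <;> intro hle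
  · exact h₁ (hxy.trans_le hle)
  · exact h₂ (hxy'.trans_le hle)
  · exact h₁ ((hxy.trans_le hle).trans hxy')
  · rcases hle.eq_or_lt with rfl | hlt
    · exact h₁ (hxy.trans hxy')
    · exact h₂ hlt
  · rcases hle.eq_or_lt with rfl | hlt
    · exact h₂ (hxy'.trans hxy)
    · exact h₁ hlt
  · exact h₂ ((hxy'.trans_le hle).trans hxy)
  · exact h₁ (hle.trans_lt hxy')
  · exact h₂ (hle.trans_lt hxy)

theorem downDegree_pos_iff {α : Type*} [Preorder α] [Finite α] {a : α} :
    0 < downDegree a ↔ ∃ b, b < a :=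
  Set.ncard_pos

theorem IsSemiorder.downDegree_lt {α : Type*} [PartialOrder α] [Finite α] (h : IsSemiorder α)
    {x y y' : α} (hxy : x < y) (hxy' : ¬ x < y') : downDegree y' < downDegree y := by
  refine Set.ncard_lt_ncard ?_
  refine (Set.ssubset_iff_of_subset fun x' hx' => ?_).2 ⟨x, hxy, hxy'⟩
  exact (h.lt_or_lt hxy hx').resolve_left hxy'

/-- A ranking that turns the order into the comparison of minimal with non-minimal elements. -/
theorem IsSemiorder.exists_rank {α : Type*} [PartialOrder α] [Finite α] (h : IsSemiorder α)
    (hc : ¬ HasChain α 3) :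
    ∃ r : α → ℕ, (∀ x y, x < y ↔ downDegree x = 0 ∧ 0 < downDegree y ∧ r x < r y) ∧
      ∀ x y, downDegree x = 0 → 0 < downDegree y → r x ≠ r y := by
  classical
  cases nonempty_fintype α
  let key : α → ℕ := fun x => (Finset.univ.filter fun y => ¬ x < y).sup downDegree
  refine ⟨fun x => if downDegree x = 0 then 2 * key x + 1 else 2 * downDegree x, ?_, ?_⟩
  · intro x y
    constructor
    · intro hxy
      have hy : 0 < downDegree y := downDegree_pos_iff.2 ⟨x, hxy⟩
      have hx : downDegree x = 0 := by
        by_contra hx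
        obtain ⟨b, hb⟩ := downDegree_pos_iff.1 (Nat.pos_of_ne_zero hx)
        exact hc (hasChain_three_iff.2 ⟨b, x, y, hb, hxy⟩)
      have hkey : key x < downDegree y := by
        refine (Finset.sup_lt_iff hy).2 fun y' hy' => h.downDegree_lt hxy ?_
        simpa using hy'
      refine ⟨hx, hy, ?_⟩
      simp only [hx, hy.ne', if_true, if_false]
      omega
    · rintro ⟨hx, hy, hlt⟩
      by_contra hxy
      have hkey : downDegree y ≤ key x :=
        Finset.le_sup (f := downDegree) (Finset.mem_filter.2 ⟨Finset.mem_univ y, hxy⟩)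
      simp only [hx, hy.ne', if_true, if_false] at hlt
      omega
  · intro x y hx hy
    simp only [hx, hy.ne', if_true, if_false]
    omega

theorem IsSemiorder.exists_isWordOf {α : Type*} [PartialOrder α] {m : ℕ} (e₀ : Fin (m + 1) ≃ α)
    (h : IsSemiorder α) (hc : ¬ HasChain α 3) :
    ∃ (w : Fin (m + 1) → Bool) (e : Fin (m + 1) ≃ α), w 0 = false ∧ IsWordOf w e := by
  have : Finite α := Finite.of_equiv _ e₀
  obtain ⟨r, hr, hne⟩ := h.exists_rank hc
  let e : Fin (m + 1) ≃ α := (Tuple.sort (r ∘ e₀)).trans e₀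
  have hmono : Monotone (r ∘ e) := Tuple.monotone_sort (r ∘ e₀)
  refine ⟨fun i => decide (0 < downDegree (e i)), e, ?_, ?_⟩
  · rw [decide_eq_false_iff_not, downDegree_pos_iff]
    rintro ⟨b, hb⟩
    obtain ⟨i, rfl⟩ := e.surjective b
    exact absurd ((hr _ _).1 hb).2.2 (not_lt.2 (hmono (Fin.zero_le i)))
  · intro i j
    rw [hr]
    simp only [decide_eq_false_iff_not, decide_eq_true_eq, Nat.pos_iff_ne_zero, not_not]
    constructor
    · rintro ⟨hi, hj, hlt⟩
      exact ⟨lt_of_not_ge fun hji => absurd hlt (not_lt.2 (hmono hji)), hi, hj⟩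
    · rintro ⟨hij, hi, hj⟩
      exact ⟨hi, hj, lt_of_le_of_ne (hmono hij.le) (hne _ _ hi (Nat.pos_of_ne_zero hj))⟩

theorem semiLenLe_wordOrder {n : ℕ} (w : Fin n → Bool) : SemiLenLe n 1 (wordOrder w) :=
  ⟨@IsWordOf.isSemiorder _ (wordOrder w) _ _ _ (isWordOf_wordOrder w),
    @IsWordOf.not_hasChain_three _ (wordOrder w).toPreorder _ _ _ (isWordOf_wordOrder w)⟩

theorem IsWordOf.le_iff {α : Type*} [PartialOrder α] {n : ℕ} {w : Fin n → Bool} {e : Fin n ≃ α}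
    (h : IsWordOf w e) (i j : Fin n) : (wordOrder w).le i j ↔ e i ≤ e j := by
  rw [le_iff_eq_or_lt, h i j, e.injective.eq_iff]
  rfl

theorem fLe_one_succ (m : ℕ) : fLe 1 (m + 1) = 2 ^ m := by
  rw [fLe, countPosets]
  have hcard : Nat.card (Fin m → Bool) = 2 ^ m := by simp
  rw [← hcard]
  symm
  refine Nat.card_congr (Equiv.ofBijective (fun w => Quot.mk _
    ⟨wordOrder (Fin.cons false w : Fin (m + 1) → Bool), semiLenLe_wordOrder _⟩) ⟨?_, ?_⟩)
  · intro w w' hw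
    have hpos := congrArg (Quot.lift (fun P => @zeroPositions (Fin (m + 1)) P.1.toPreorder) (by
      rintro P Q ⟨e, he⟩
      exact @zeroPositions_congr _ _ P.1.toPreorder Q.1.toPreorder
        ⟨e, fun {a b} => (he a b).symm⟩)) hw
    dsimp only at hpos
    rw [@IsWordOf.zeroPositions_eq _ (wordOrder _).toPreorder _ _ _ (isWordOf_wordOrder _) rfl,
      @IsWordOf.zeroPositions_eq _ (wordOrder _).toPreorder _ _ _ (isWordOf_wordOrder _) rfl] at hpos
    replace hpos := Finset.image_injective Fin.val_injective hpos
    funext i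
    have hi := Finset.ext_iff.1 hpos i.succ
    simp only [Finset.mem_filter, Finset.mem_univ, true_and, Fin.cons_succ] at hi
    exact Bool.eq_iff_iff.2 (by simpa using not_congr hi)
  · intro q
    obtain ⟨⟨P, hP⟩, rfl⟩ := Quot.exists_rep q
    obtain ⟨w, e, h0, he⟩ := @IsSemiorder.exists_isWordOf _ P m (Equiv.refl _) hP.1 hP.2
    refine ⟨Fin.tail w, Quot.sound ⟨e, fun i j => ?_⟩⟩
    have hw : (Fin.cons false (Fin.tail w) : Fin (m + 1) → Bool) = w := by
      rw [← h0, Fin.cons_self_tail]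
    rw [hw]
    exact @IsWordOf.le_iff _ P _ _ _ he i j

theorem statement10 (n : ℕ) (hn : 1 ≤ n) : fLe 1 n = 2 ^ (n - 1) := by
  obtain ⟨m, rfl⟩ := Nat.exists_eq_add_of_le' hn
  exact fLe_one_succ m

end Paper
end
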